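/- arXiv:1509.02643 — 4 statements merged into one kernel-verified Lean document; each statement's English description precedes it below -/
import Mathlib

section
/- Let A be a C*-algebra, let B be a nonzero hereditary C*-subalgebra of A, and let π be an irreducible representation of A on a complex Hilbert space H such that the closed linear span K_π(B) of {π(b)x : b ∈ B, x ∈ H} equals H. Then: (i) for every unit vector x ∈ H the functional b ↦ ⟨x, π(b)x⟩ on B is a pure state of B; (ii) for unit vectors x, y ∈ H, if ⟨x, π(b)x⟩ = ⟨y, π(b)y⟩ for all b ∈ B then ⟨x, π(a)x⟩ = ⟨y, π(a)y⟩ for all a ∈ A; and (iii) for every unit vector x ∈ H, the vector state ω_x^π is the unique pure state of A whose restriction to B equals b ↦ ⟨x, π(b)x⟩. -/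
open scoped ComplexOrder InnerProductSpace

noncomputable section

variable (A : Type*) [NonUnitalNormedRing A] [NormedSpace ℂ A] [StarRing A]

/-- A state on a C*-algebra: a continuous linear functional which is positive
(`φ (a* a) ≥ 0` in the complex order) and of norm one. -/
def IsState (φ : A →L[ℂ] ℂ) : Prop :=
  (∀ a : A, 0 ≤ φ (star a * a)) ∧ ‖φ‖ = 1

/-- A pure state: an extreme point of the set of states. -/
def IsPureState (φ : A →L[ℂ] ℂ) : Prop :=
  φ ∈ Set.extremePoints ℝ {ψ : A →L[ℂ] ℂ | IsState A ψ}

section Hereditary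

variable [PartialOrder A] [StarOrderedRing A]

/-- A hereditary C*-subalgebra: a closed *-subalgebra `B` such that
`0 ≤ a ≤ b` with `b ∈ B` implies `a ∈ B`. -/
def IsHereditary (B : NonUnitalStarSubalgebra ℂ A) : Prop :=
  IsClosed (B : Set A) ∧ ∀ a : A, ∀ b ∈ B, 0 ≤ a → a ≤ b → a ∈ B

end Hereditary

variable {H : Type*} [NormedAddCommGroup H] [InnerProductSpace ℂ H] [CompleteSpace H]

/-- Irreducibility of a representation: the space is nonzero and the only closed
invariant subspaces are `⊥` and `⊤`. -/
def IsIrredRep (π : A →⋆ₙₐ[ℂ] (H →L[ℂ] H)) : Prop :=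
  (∃ x : H, x ≠ 0) ∧
  ∀ K : Submodule ℂ H, IsClosed (K : Set H) → (∀ a : A, ∀ x ∈ K, π a x ∈ K) → K = ⊥ ∨ K = ⊤

/-- `K_π(S)`: the closed linear span of `{π b x : b ∈ S, x ∈ H}`. -/
def repSpan (π : A →⋆ₙₐ[ℂ] (H →L[ℂ] H)) (S : Set A) : Submodule ℂ H :=
  (Submodule.span ℂ {y : H | ∃ b ∈ S, ∃ x : H, y = π b x}).topologicalClosure


section PositiveFunctional

variable {A : Type*} [NonUnitalCStarAlgebra A]

/-- A functional nonnegative on all `a* a`, bundled as a positive linear map. -/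
def positiveLinearMapOfStarMulSelf [PartialOrder A] [StarOrderedRing A] (φ : A →L[ℂ] ℂ)
    (hφ : ∀ a, 0 ≤ φ (star a * a)) : A →ₚ[ℂ] ℂ :=
  PositiveLinearMap.mk₀ φ.toLinearMap fun a ha ↦ by
    obtain ⟨b, rfl⟩ := CStarAlgebra.nonneg_iff_eq_star_mul_self.mp ha
    exact hφ b

variable (φ : A →L[ℂ] ℂ)

/-- A positive functional is hermitian. -/
lemma apply_star_of_star_mul_self_nonneg (hφ : ∀ a, 0 ≤ φ (star a * a)) (a : A) :
    φ (star a) = star (φ a) := by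
  let _ := CStarAlgebra.spectralOrder A
  have := CStarAlgebra.spectralOrderedRing A
  exact map_star (positiveLinearMapOfStarMulSelf φ hφ) a

/-- The Cauchy–Schwarz inequality for positive functionals. -/
lemma norm_sq_apply_star_mul_le (hφ : ∀ a, 0 ≤ φ (star a * a)) (a b : A) :
    ‖φ (star a * b)‖ ^ 2 ≤ (φ (star a * a)).re * (φ (star b * b)).re := by
  let _ := CStarAlgebra.spectralOrder A
  have := CStarAlgebra.spectralOrderedRing A
  let f := positiveLinearMapOfStarMulSelf φ hφ
  have key := norm_inner_le_norm (𝕜 := ℂ) (f.toPreGNS a) (f.toPreGNS b)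
  have hsq (c : A) : ‖f.toPreGNS c‖ ^ 2 = (φ (star c * c)).re := by
    exact Real.sq_sqrt (Complex.nonneg_iff.mp (hφ c)).1
  rw [← hsq, ← hsq, ← mul_pow]
  exact pow_le_pow_left₀ (norm_nonneg _) key 2

open Filter Topology in
/-- Cauchy–Schwarz for the product of `1 - u*` and `a`, with `‖φ‖` in the role of `φ 1`. -/
lemma norm_sq_apply_sub_star_mul_le (hφ : ∀ a, 0 ≤ φ (star a * a)) (u a : A) :
    ‖φ (a - star u * a)‖ ^ 2 ≤
      (‖φ‖ - 2 * (φ u).re + (φ (star u * u)).re) * (φ (star a * a)).re := by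
  let _ := CStarAlgebra.spectralOrder A
  have := CStarAlgebra.spectralOrderedRing A
  have hl := CStarAlgebra.increasingApproximateUnit A
  set l := CStarAlgebra.approximateUnit A
  have h1 : Tendsto (fun e : A ↦ ‖φ (e * a - star u * a)‖ ^ 2) l
      (𝓝 (‖φ (a - star u * a)‖ ^ 2)) :=
    ((φ.continuous.tendsto _).comp ((hl.tendsto_mul_right a).sub_const _)).norm.pow 2
  have h2 : Tendsto (fun e : A ↦
      (‖φ‖ - (φ (e * u)).re - (φ (star u * e)).re + (φ (star u * u)).re) *
        (φ (star a * a)).re) l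
      (𝓝 ((‖φ‖ - (φ u).re - (φ (star u)).re + (φ (star u * u)).re) * (φ (star a * a)).re)) := by
    have hc : Continuous fun x ↦ (φ x).re := Complex.continuous_re.comp φ.continuous
    exact ((((hc.tendsto _).comp (hl.tendsto_mul_right u)).const_sub _ |>.sub
      ((hc.tendsto _).comp (hl.tendsto_mul_left (star u)))).add_const _).mul_const _
  rw [apply_star_of_star_mul_self_nonneg φ hφ] at h2
  have h3 := le_of_tendsto_of_tendsto h1 h2 ?_
  · convert! h3 using 2
    simp; ring
  filter_upwards [hl.eventually_star_eq, hl.eventually_norm] with e he he1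
  have cs := norm_sq_apply_star_mul_le φ hφ (e - u) a
  have hee : (φ (e * e)).re ≤ ‖φ‖ :=
    calc (φ (e * e)).re ≤ ‖φ (e * e)‖ := Complex.re_le_norm _
      _ ≤ ‖φ‖ * ‖e * e‖ := φ.le_opNorm _
      _ ≤ ‖φ‖ * (‖e‖ * ‖e‖) := by gcongr; exact norm_mul_le _ _
      _ ≤ ‖φ‖ * (1 * 1) := by gcongr
      _ = ‖φ‖ := by ring
  rw [star_sub, he, sub_mul] at cs
  refine cs.trans (mul_le_mul_of_nonneg_right ?_ (Complex.nonneg_iff.mp (hφ a)).1)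
  simp only [sub_mul, mul_sub, map_sub, Complex.sub_re]
  linarith

end PositiveFunctional

section VectorFunctional

variable {A : Type*} [NonUnitalCStarAlgebra A] (π : A →⋆ₙₐ[ℂ] (H →L[ℂ] H))

/-- The orbit map `a ↦ π a x`. -/
def orbitMap (x : H) : A →ₗ[ℂ] H where
  toFun a := π a x
  map_add' := by simp
  map_smul' := by simp

@[simp]
lemma orbitMap_apply (x : H) (a : A) : orbitMap π x a = π a x := rfl

lemma norm_rep_apply_le (a : A) (x : H) : ‖π a x‖ ≤ ‖a‖ * ‖x‖ :=
  ((π a).le_opNorm x).trans <| by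
    gcongr
    exact NonUnitalStarAlgHom.norm_apply_le π a

/-- The vector functional `a ↦ ⟪x, π a x⟫`. -/
def vectorFunctional (x : H) : A →L[ℂ] ℂ :=
  ((innerSL ℂ x).toLinearMap ∘ₗ orbitMap π x).mkContinuous (‖x‖ * ‖x‖) fun a ↦
    (norm_inner_le_norm x (π a x)).trans <| by
      calc ‖x‖ * ‖π a x‖ ≤ ‖x‖ * (‖a‖ * ‖x‖) := by gcongr; exact norm_rep_apply_le π a x
        _ = ‖x‖ * ‖x‖ * ‖a‖ := by ring

@[simp]
lemma vectorFunctional_apply (x : H) (a : A) : vectorFunctional π x a = ⟪x, π a x⟫_ℂ := rfl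

lemma inner_self_eq_ofReal_norm_sq {E : Type*} [NormedAddCommGroup E] [InnerProductSpace ℂ E]
    (y : E) : ⟪y, y⟫_ℂ = ((‖y‖ ^ 2 : ℝ) : ℂ) := by
  rw [inner_self_eq_norm_sq_to_K]
  simp

lemma inner_rep_star_left (a : A) (x y : H) : ⟪π (star a) x, y⟫_ℂ = ⟪x, π a y⟫_ℂ := by
  rw [map_star, ContinuousLinearMap.star_eq_adjoint, ContinuousLinearMap.adjoint_inner_left]

lemma inner_rep_star_mul (a b : A) (x y : H) : ⟪x, π (star a * b) y⟫_ℂ = ⟪π a x, π b y⟫_ℂ := by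
  rw [map_mul, mul_apply_eq_comp, ← inner_rep_star_left, star_star]

lemma vectorFunctional_star_mul_self (x : H) (a : A) :
    vectorFunctional π x (star a * a) = ((‖π a x‖ ^ 2 : ℝ) : ℂ) := by
  rw [vectorFunctional_apply, inner_rep_star_mul, inner_self_eq_ofReal_norm_sq]

lemma vectorFunctional_star_mul_self_nonneg (x : H) (a : A) :
    0 ≤ vectorFunctional π x (star a * a) := by
  rw [vectorFunctional_star_mul_self]
  exact Complex.zero_le_real.mpr (sq_nonneg _)

lemma norm_vectorFunctional_le {x : H} (hx : ‖x‖ = 1) : ‖vectorFunctional π x‖ ≤ 1 := by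
  refine (LinearMap.mkContinuous_norm_le _ (by positivity) _).trans ?_
  simp [hx]

/-- A unit vector which is cyclic for the representation gives a vector state. -/
lemma isState_vectorFunctional {x : H} (hx : ‖x‖ = 1) (hcyc : DenseRange (orbitMap π x)) :
    IsState A (vectorFunctional π x) := by
  refine ⟨vectorFunctional_star_mul_self_nonneg π x, (norm_vectorFunctional_le π hx).antisymm ?_⟩
  have h (y : H) : ‖⟪x, y⟫_ℂ‖ ^ 2 ≤ ‖vectorFunctional π x‖ * ‖y‖ ^ 2 := by
    refine hcyc.induction_on y (isClosed_le (by fun_prop) (by fun_prop)) fun a ↦ ?_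
    have := norm_sq_apply_sub_star_mul_le _ (vectorFunctional_star_mul_self_nonneg π x) 0 a
    rw [vectorFunctional_star_mul_self π x a, Complex.ofReal_re] at this
    simpa using this
  simpa [hx] using h x

/-- Irreducible representations that are not zero are cyclic for every nonzero vector. -/
lemma IsIrredRep.denseRange_orbitMap {π : A →⋆ₙₐ[ℂ] (H →L[ℂ] H)} (hπ : IsIrredRep A π)
    (hne : ∃ a, π a ≠ 0) {x : H} (hx : x ≠ 0) : DenseRange (orbitMap π x) := by
  have hinv : ∀ a, ∀ y ∈ (LinearMap.range (orbitMap π x)).topologicalClosure,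
      π a y ∈ (LinearMap.range (orbitMap π x)).topologicalClosure := by
    intro a
    refine fun y hy ↦ map_mem_closure (π a).continuous hy ?_
    rintro _ ⟨b, rfl⟩
    exact ⟨a * b, by simp⟩
  rcases hπ.2 _ (Submodule.isClosed_topologicalClosure _) hinv with h | h
  · exfalso
    have hx0 : ∀ a, π a x = 0 := fun a ↦ by
      rw [← Submodule.mem_bot ℂ, ← h]
      exact Submodule.le_topologicalClosure _ ⟨a, rfl⟩
    let N : Submodule ℂ H := ⨅ a, LinearMap.ker (π a).toLinearMap
    have hN (y : H) : y ∈ N ↔ ∀ a, π a y = 0 := by simp [N]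
    have hNc : IsClosed (N : Set H) := by
      have : (N : Set H) = ⋂ a, {y | π a y = 0} := by ext y; simp [hN]
      rw [this]
      exact isClosed_iInter fun a ↦ isClosed_eq (π a).continuous continuous_const
    rcases hπ.2 N hNc fun a y hy ↦ by simp [(hN y).1 hy a] with h' | h'
    · exact hx (by simpa [h'] using (hN x).2 hx0)
    · obtain ⟨a, ha⟩ := hne
      exact ha (by ext y; exact (hN y).1 (h' ▸ Submodule.mem_top) a)
  · intro y
    have : y ∈ (LinearMap.range (orbitMap π x)).topologicalClosure := h ▸ Submodule.mem_top
    exact this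

/-- Schur's lemma for selfadjoint operators. -/
lemma IsIrredRep.exists_eq_algebraMap {π : A →⋆ₙₐ[ℂ] (H →L[ℂ] H)} (hπ : IsIrredRep A π)
    {T : H →L[ℂ] H} (hT : IsSelfAdjoint T) (hcomm : ∀ a, Commute T (π a)) :
    ∃ c : ℝ, T = algebraMap ℝ (H →L[ℂ] H) c := by
  obtain ⟨x₀, hx₀⟩ := hπ.1
  have : Nontrivial H := ⟨x₀, 0, hx₀⟩
  have hdich (f g : ℝ → ℝ) (hf : Continuous f) (hg : Continuous g) (hfg : ∀ t, f t * g t = 0) :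
      cfc f T = 0 ∨ cfc g T = 0 := by
    have hmul : cfc f T * cfc g T = 0 := by
      rw [← cfc_mul f g T hf.continuousOn hg.continuousOn]
      simp [hfg]
    have hfc (a : A) := (hcomm a).cfc_real f
    rcases hπ.2 (LinearMap.ker (cfc f T).toLinearMap) (cfc f T).isClosed_ker (fun a y hy ↦ by
      have h1 := DFunLike.congr_fun (hfc a).eq y
      simp only [mul_apply_eq_comp] at h1
      have hy' : cfc f T y = 0 := hy
      show cfc f T (π a y) = 0
      rw [h1, hy', map_zero]) with h | h
    · right
      ext y
      have : cfc g T y ∈ LinearMap.ker (cfc f T).toLinearMap := DFunLike.congr_fun hmul y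
      simpa [h] using this
    · left
      ext y
      have : y ∈ LinearMap.ker (cfc f T).toLinearMap := h ▸ Submodule.mem_top
      exact this
  have hsub : ∀ s ∈ spectrum ℝ T, ∀ t ∈ spectrum ℝ T, ¬ s < t := by
    intro s hs t ht hst
    have hval (f : ℝ → ℝ) (hf : Continuous f) (h0 : cfc f T = 0) {r : ℝ} (hr : r ∈ spectrum ℝ T) :
        f r = 0 := by
      have : f r ∈ spectrum ℝ (cfc f T) := by
        rw [cfc_map_spectrum f T hT hf.continuousOn]
        exact ⟨r, hr, rfl⟩
      simpa [h0] using this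
    rcases hdich (fun r ↦ max (r - (s + t) / 2) 0) (fun r ↦ max ((s + t) / 2 - r) 0)
      (by fun_prop) (by fun_prop) (fun r ↦ by
        rcases le_total r ((s + t) / 2) with h | h
        · simp [max_eq_right (sub_nonpos.mpr h)]
        · simp [max_eq_right (sub_nonpos.mpr h)]) with h | h
    · have := hval _ (by fun_prop) h ht
      simp only [max_eq_right_iff] at this
      linarith
    · have := hval _ (by fun_prop) h hs
      simp only [max_eq_right_iff] at this
      linarith
  obtain ⟨c, hc⟩ := ContinuousFunctionalCalculus.spectrum_nonempty (R := ℝ) T hT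
  refine ⟨c, ?_⟩
  rw [← cfc_const c T]
  conv_lhs => rw [← cfc_id' ℝ T]
  exact cfc_congr fun r hr ↦ le_antisymm (not_lt.mp (hsub c hc r hr)) (not_lt.mp (hsub r hr c hc))

end VectorFunctional

section PureState

variable {A : Type*} [NonUnitalCStarAlgebra A] {π : A →⋆ₙₐ[ℂ] (H →L[ℂ] H)}

/-- A positive functional dominated by a multiple of a vector functional of an irreducible
representation is a multiple of that vector functional. -/
lemma IsIrredRep.exists_eq_smul_vectorFunctional (hπ : IsIrredRep A π) {x : H}
    (hcyc : DenseRange (orbitMap π x)) (φ : A →L[ℂ] ℂ) (hφ : ∀ a, 0 ≤ φ (star a * a)) {C : ℝ}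
    (hC : 0 ≤ C) (hle : ∀ a, (φ (star a * a)).re ≤ C * ‖π a x‖ ^ 2) :
    ∃ c : ℝ, 0 ≤ c ∧ φ = (c : ℂ) • vectorFunctional π x := by
  let _ := CStarAlgebra.spectralOrder A
  have := CStarAlgebra.spectralOrderedRing A
  let f := positiveLinearMapOfStarMulSelf φ hφ
  let q : A →ₗ[ℂ] f.GNS := UniformSpace.Completion.toComplL.toLinearMap ∘ₗ f.toPreGNS.toLinearMap
  have hq (a b : A) : ⟪q a, q b⟫_ℂ = φ (star a * b) :=
    UniformSpace.Completion.inner_coe (𝕜 := ℂ) (f.toPreGNS a) (f.toPreGNS b)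
  have hbound (a : A) : ‖q a‖ ≤ √C * ‖orbitMap π x a‖ := by
    rw [← Real.sqrt_sq (norm_nonneg (orbitMap π x a)), ← Real.sqrt_mul hC]
    refine Real.le_sqrt_of_sq_le ((le_of_eq ?_).trans (hle a))
    rw [← hq, inner_self_eq_ofReal_norm_sq, Complex.ofReal_re]
  let V : H →L[ℂ] f.GNS := q.extendOfNorm (orbitMap π x)
  have hV (a : A) : V (π a x) = q a := LinearMap.extendOfNorm_eq hcyc ⟨_, hbound⟩ a
  let T : H →L[ℂ] H := ContinuousLinearMap.adjoint V ∘L V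
  have hT (y z : H) : ⟪y, T z⟫_ℂ = ⟪V y, V z⟫_ℂ := by
    simp [T, ContinuousLinearMap.adjoint_inner_right]
  have hTsa : IsSelfAdjoint T := (ContinuousLinearMap.isPositive_adjoint_comp_self V).isSelfAdjoint
  have hcomm (a : A) : Commute T (π a) := by
    ext z
    refine ext_inner_left ℂ fun y ↦ ?_
    simp only [mul_apply_eq_comp]
    rw [hT, ← inner_rep_star_left, hT]
    refine hcyc.induction_on₂ (p := fun y z ↦ ⟪V y, V (π a z)⟫_ℂ = ⟪V (π (star a) y), V z⟫_ℂ)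
      (isClosed_eq (by fun_prop) (by fun_prop)) (fun b c ↦ ?_) y z
    have hrep (d e : A) : π d (π e x) = π (d * e) x := by simp
    rw [orbitMap_apply, orbitMap_apply, hrep, hrep, hV, hV, hV, hV, hq, hq, star_mul, star_star,
      mul_assoc]
  obtain ⟨c, hc⟩ := hπ.exists_eq_algebraMap hTsa hcomm
  have hTc (y : H) : T y = (c : ℂ) • y := by
    rw [hc, Algebra.algebraMap_eq_smul_one]; simp
  have hmul (a b : A) : φ (star a * b) = c * ⟪x, π (star a * b) x⟫_ℂ := by
    rw [← hq, ← hV, ← hV, ← hT, hTc, inner_smul_right, inner_rep_star_mul]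
  obtain ⟨x₀, hx₀⟩ := hπ.1
  have hc0 : 0 ≤ c := by
    have h := hT x₀ x₀
    rw [hTc, inner_smul_right, inner_self_eq_ofReal_norm_sq, inner_self_eq_ofReal_norm_sq] at h
    have h' : c * ‖x₀‖ ^ 2 = ‖V x₀‖ ^ 2 := by exact_mod_cast h
    by_contra! hneg
    nlinarith [norm_pos_iff.mpr hx₀, sq_nonneg ‖V x₀‖, pow_pos (norm_pos_iff.mpr hx₀) 2]
  refine ⟨c, hc0, ?_⟩
  ext a
  have hl := CStarAlgebra.increasingApproximateUnit A
  have h1 := (φ.continuous.tendsto _).comp (hl.tendsto_mul_right a)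
  have h2 := (((c : ℂ) • vectorFunctional π x).continuous.tendsto _).comp (hl.tendsto_mul_right a)
  refine tendsto_nhds_unique_of_eventuallyEq h1 h2 ?_
  filter_upwards [hl.eventually_star_eq] with e he
  have := hmul e a
  rw [he] at this
  exact this

/-- Vector states of nonzero irreducible representations are pure. -/
lemma IsIrredRep.isPureState_vectorFunctional (hπ : IsIrredRep A π) (hne : ∃ a, π a ≠ 0)
    {x : H} (hx : ‖x‖ = 1) : IsPureState A (vectorFunctional π x) := by
  have hcyc := hπ.denseRange_orbitMap hne (x := x) (by rintro rfl; simp at hx)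
  have hst := isState_vectorFunctional π hx hcyc
  refine mem_extremePoints_iff_left.mpr ⟨hst, ?_⟩
  rintro φ hφ ψ hψ ⟨s, t, hs, ht, -, hst'⟩
  obtain ⟨c, hc, rfl⟩ := hπ.exists_eq_smul_vectorFunctional hcyc φ hφ.1 (C := s⁻¹)
    (by positivity) fun a ↦ by
      have h := congrArg Complex.re (DFunLike.congr_fun hst' (star a * a))
      rw [vectorFunctional_star_mul_self] at h
      simp only [add_apply, smul_apply, Complex.add_re,
        Complex.real_smul, Complex.re_ofReal_mul, Complex.ofReal_re] at h
      have := mul_nonneg ht.le (Complex.nonneg_iff.mp (hψ.1 a)).1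
      rw [inv_mul_eq_div, le_div_iff₀ hs]
      linarith
  have h1 := hφ.2
  rw [norm_smul, hst.2, mul_one, Complex.norm_real, Real.norm_of_nonneg hc] at h1
  simp [h1]

end PureState

section Hereditary

variable {A : Type*} [NonUnitalCStarAlgebra A]

/-- `B A B ⊆ B` for a hereditary C*-subalgebra `B`. -/
lemma IsHereditary.mul_mul_mem [PartialOrder A] [StarOrderedRing A]
    {B : NonUnitalStarSubalgebra ℂ A} (hB : IsHereditary A B) {b c : A} (hb : b ∈ B) (hc : c ∈ B)
    (a : A) : b * a * c ∈ B := by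
  have hconj {a : A} (ha : 0 ≤ a) {d : A} (hd : d ∈ B) : star d * a * d ∈ B := by
    refine hB.2 _ (‖a‖ • (star d * d)) ?_ (star_left_conjugate_nonneg ha d)
      CStarAlgebra.star_left_conjugate_le_norm_smul
    rw [← Complex.coe_smul]
    exact SMulMemClass.smul_mem _ (mul_mem (star_mem hd) hd)
  have hspan : a ∈ Submodule.span ℂ {a : A | 0 ≤ a} := by
    rw [CStarAlgebra.span_nonneg]; trivial
  induction hspan using Submodule.span_induction with
  | zero => simp
  | add p q _ _ hp hq => rw [mul_add, add_mul]; exact add_mem hp hq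
  | smul r p _ hp =>
    rw [mul_smul_comm, smul_mul_assoc]
    exact SMulMemClass.smul_mem _ hp
  | mem a ha =>
    let q (d : A) := star d * a * d
    have hq {d : A} (hd : d ∈ B) : q d ∈ B := hconj ha hd
    have hb' := star_mem hb
    have hIc : Complex.I • c ∈ B := SMulMemClass.smul_mem _ hc
    have hpol : b * a * c = (4⁻¹ : ℂ) • (q (star b + c) - q (star b - c)
        - Complex.I • (q (star b + Complex.I • c) - q (star b - Complex.I • c))) := by
      simp only [q, star_add, star_sub, star_star, star_smul, Complex.star_def, Complex.conj_I,
        add_mul, mul_add, sub_mul, mul_sub, smul_mul_assoc, mul_smul_comm, smul_sub, smul_add,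
        smul_smul]
      match_scalars <;> ring_nf <;> simp; norm_num
    rw [hpol]
    exact SMulMemClass.smul_mem _ (sub_mem (sub_mem (hq (add_mem hb' hc)) (hq (sub_mem hb' hc)))
      (SMulMemClass.smul_mem _ (sub_mem (hq (add_mem hb' hIc)) (hq (sub_mem hb' hIc)))))

variable {π : A →⋆ₙₐ[ℂ] (H →L[ℂ] H)} {B : NonUnitalStarSubalgebra ℂ A}

/-- If a representation is nondegenerate on `B`, then `B` annihilates no nonzero vector. -/
lemma eq_zero_of_repSpan_eq_top (hK : repSpan A π (B : Set A) = ⊤) {x : H}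
    (hx : ∀ b ∈ B, π b x = 0) : x = 0 := by
  have hle : repSpan A π (B : Set A) ≤ (ℂ ∙ x)ᗮ := by
    refine Submodule.topologicalClosure_minimal _ (Submodule.span_le.mpr ?_)
      (Submodule.isClosed_orthogonal _)
    rintro _ ⟨b, hb, y, rfl⟩
    refine Submodule.mem_orthogonal_singleton_iff_inner_right.mpr ?_
    rw [← inner_rep_star_left, hx _ (star_mem hb), inner_zero_left]
  rw [hK] at hle
  have : x ∈ (ℂ ∙ x)ᗮ := hle trivial
  exact inner_self_eq_zero.mp (Submodule.mem_orthogonal_singleton_iff_inner_right.mp this)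

/-- An irreducible representation restricts to an irreducible representation of `B`
if it is nondegenerate on `B` and `B A B ⊆ B`. -/
lemma IsIrredRep.comp_subtype (hπ : IsIrredRep A π)
    (hBAB : ∀ b ∈ B, ∀ c ∈ B, ∀ a, b * a * c ∈ B) (hK : repSpan A π (B : Set A) = ⊤) :
    IsIrredRep B (π.comp (NonUnitalStarSubalgebraClass.subtype B)) := by
  refine ⟨hπ.1, fun K hKc hinv ↦ or_iff_not_imp_left.mpr fun hK0 ↦ ?_⟩
  obtain ⟨x, hxK, hx0⟩ := Submodule.exists_mem_ne_zero_of_ne_bot hK0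
  obtain ⟨c, hc, hcx⟩ : ∃ c ∈ B, π c x ≠ 0 := by
    by_contra! h
    exact hx0 (eq_zero_of_repSpan_eq_top hK h)
  have hcyc := hπ.denseRange_orbitMap ⟨c, fun h ↦ hcx (by simp [h])⟩ hcx
  rw [eq_top_iff, ← hK]
  refine Submodule.topologicalClosure_minimal _ (Submodule.span_le.mpr ?_) hKc
  rintro _ ⟨b, hb, y, rfl⟩
  refine hcyc.induction_on y (p := fun y ↦ π b y ∈ K)
    (hKc.preimage (π b).continuous) fun a ↦ ?_
  have := hinv ⟨_, hBAB b hb c hc a⟩ x hxK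
  simpa using this

/-- A state agreeing with a vector functional on `B` is close to its compression by `u ∈ B`
when `u` almost fixes the vector. -/
lemma norm_apply_sub_conjugate_le (hBAB : ∀ b ∈ B, ∀ c ∈ B, ∀ a, b * a * c ∈ B)
    {φ : A →L[ℂ] ℂ} (hφ : IsState A φ) {x : H} (hx : ‖x‖ = 1)
    (heq : ∀ b ∈ B, φ b = ⟪x, π b x⟫_ℂ) {u : A} (hu : u ∈ B) (a : A) :
    ‖φ a - φ (star u * a * u)‖ ≤ ‖x - π u x‖ * (‖a‖ + ‖a‖ * ‖π u x‖) := by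
  have hdefect : ‖φ‖ - 2 * (φ u).re + (φ (star u * u)).re = ‖x - π u x‖ ^ 2 := by
    rw [heq _ hu, heq _ (mul_mem (star_mem hu) hu), inner_rep_star_mul, hφ.2,
      @norm_sub_sq ℂ, hx, inner_self_eq_ofReal_norm_sq, Complex.ofReal_re]
    simp
  have hsub (c : A) {r : ℝ} (hr : 0 ≤ r) (hc : (φ (star c * c)).re ≤ r ^ 2) :
      ‖φ (c - star u * c)‖ ≤ ‖x - π u x‖ * r := by
    refine le_of_sq_le_sq ?_ (by positivity)
    rw [mul_pow]
    refine (norm_sq_apply_sub_star_mul_le φ hφ.1 u c).trans ?_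
    rw [hdefect]
    gcongr
  have h1 : ‖φ (a - star u * a)‖ ≤ ‖x - π u x‖ * ‖a‖ := by
    refine hsub a (norm_nonneg a) ?_
    calc (φ (star a * a)).re ≤ ‖φ (star a * a)‖ := Complex.re_le_norm _
      _ ≤ ‖φ‖ * ‖star a * a‖ := φ.le_opNorm _
      _ = ‖a‖ ^ 2 := by rw [hφ.2, CStarRing.norm_star_mul_self, one_mul, sq]
  have h2 : ‖φ (star a * u - star u * (star a * u))‖ ≤ ‖x - π u x‖ * (‖a‖ * ‖π u x‖) := by
    refine hsub (star a * u) (by positivity) ?_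
    have hmem : star (star a * u) * (star a * u) ∈ B := by
      simpa [mul_assoc] using hBAB _ (star_mem hu) _ hu (a * star a)
    rw [heq _ hmem, inner_rep_star_mul, inner_self_eq_ofReal_norm_sq, Complex.ofReal_re]
    gcongr
    rw [map_mul]
    simpa using norm_rep_apply_le π (star a) (π u x)
  have h3 : φ (star u * a - star u * a * u) = star (φ (star a * u - star u * (star a * u))) := by
    rw [← apply_star_of_star_mul_self_nonneg φ hφ.1]
    simp [mul_assoc]
  calc ‖φ a - φ (star u * a * u)‖
      = ‖φ (a - star u * a) + φ (star u * a - star u * a * u)‖ := by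
        rw [← map_add, ← map_sub]; congr 2; abel
    _ ≤ ‖φ (a - star u * a)‖ + ‖φ (star u * a - star u * a * u)‖ := norm_add_le _ _
    _ ≤ ‖x - π u x‖ * ‖a‖ + ‖x - π u x‖ * (‖a‖ * ‖π u x‖) := by
        rw [h3, norm_star]; exact add_le_add h1 h2
    _ = _ := by ring

/-- Two states agreeing on `B` with the same vector functional coincide if the vector lies in the
closure of its orbit under `B`. -/
lemma IsState.eq_of_eqOn (hBAB : ∀ b ∈ B, ∀ c ∈ B, ∀ a, b * a * c ∈ B) {φ ψ : A →L[ℂ] ℂ}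
    (hφ : IsState A φ) (hψ : IsState A ψ) {x : H} (hx : ‖x‖ = 1)
    (hcyc : x ∈ closure {y | ∃ b ∈ B, π b x = y})
    (hφB : ∀ b ∈ B, φ b = ⟪x, π b x⟫_ℂ) (hψB : ∀ b ∈ B, ψ b = ⟪x, π b x⟫_ℂ) : φ = ψ := by
  ext a
  let F (y : H) : ℝ := 2 * (‖x - y‖ * (‖a‖ + ‖a‖ * ‖y‖))
  have hF : ∀ y ∈ closure {y | ∃ b ∈ B, π b x = y}, ‖φ a - ψ a‖ ≤ F y := by
    refine fun y hy ↦ closure_minimal (t := {y | ‖φ a - ψ a‖ ≤ F y}) ?_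
      (isClosed_le continuous_const (by fun_prop)) hy
    rintro _ ⟨u, hu, rfl⟩
    have hmem := hBAB _ (star_mem hu) _ hu a
    have h1 := norm_apply_sub_conjugate_le hBAB hφ hx hφB hu a
    have h2 := norm_apply_sub_conjugate_le hBAB hψ hx hψB hu a
    rw [hφB _ hmem] at h1
    rw [hψB _ hmem] at h2
    have := norm_sub_le_norm_sub_add_norm_sub (φ a) ⟪x, π (star u * a * u) x⟫_ℂ (ψ a)
    rw [norm_sub_rev ⟪x, _⟫_ℂ (ψ a)] at this
    simp only [Set.mem_ofPred_eq, F]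
    linarith
  have := hF x hcyc
  rw [← sub_eq_zero, ← norm_le_zero_iff]
  simpa [F] using this

end Hereditary

theorem pure_states_of_hereditary_fullFiber
    {A : Type*} [NonUnitalNormedRing A] [NormedSpace ℂ A] [StarRing A]
    [CStarRing A] [CompleteSpace A] [IsScalarTower ℂ A A] [SMulCommClass ℂ A A]
    [StarModule ℂ A] [PartialOrder A] [StarOrderedRing A]
    (B : NonUnitalStarSubalgebra ℂ A) (hB : IsHereditary A B)
    (hBne : ∃ b ∈ B, b ≠ (0 : A))
    {H : Type*} [NormedAddCommGroup H] [InnerProductSpace ℂ H] [CompleteSpace H]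
    (π : A →⋆ₙₐ[ℂ] (H →L[ℂ] H)) (hπ : IsIrredRep A π)
    (hK : repSpan A π (B : Set A) = ⊤) :
    -- (i) every vector state restricted to B is a pure state of B
    (∀ x : H, ‖x‖ = 1 →
      ∃ τ : ↥B →L[ℂ] ℂ, IsPureState ↥B τ ∧ ∀ b : ↥B, τ b = ⟪x, π (b : A) x⟫_ℂ) ∧
    -- (ii) vector states agreeing on B agree on A
    (∀ x y : H, ‖x‖ = 1 → ‖y‖ = 1 →
      (∀ b ∈ B, ⟪x, π b x⟫_ℂ = ⟪y, π b y⟫_ℂ) →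
      ∀ a : A, ⟪x, π a x⟫_ℂ = ⟪y, π a y⟫_ℂ) ∧
    -- (iii) the vector state at x is the unique pure state of A restricting on B
    -- to b ↦ ⟪x, π b x⟫
    (∀ x : H, ‖x‖ = 1 →
      ∃ φ : A →L[ℂ] ℂ, (∀ a : A, φ a = ⟪x, π a x⟫_ℂ) ∧ IsPureState A φ ∧
        ∀ ψ : A →L[ℂ] ℂ, IsPureState A ψ → (∀ b ∈ B, ψ b = ⟪x, π b x⟫_ℂ) → ψ = φ) := by
  let _ : NonUnitalCStarAlgebra A := {}
  have hBAB : ∀ b ∈ B, ∀ c ∈ B, ∀ a, b * a * c ∈ B := fun b hb c hc a ↦ hB.mul_mul_mem hb hc a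
  have hcl : IsClosed (B : Set A) := hB.1
  let ρ : B →⋆ₙₐ[ℂ] (H →L[ℂ] H) := π.comp (NonUnitalStarSubalgebraClass.subtype B)
  have hρ : IsIrredRep B ρ := hπ.comp_subtype hBAB hK
  obtain ⟨x₀, hx₀⟩ := hπ.1
  obtain ⟨b₀, hb₀, hbx₀⟩ : ∃ b ∈ B, π b x₀ ≠ 0 := by
    by_contra! h
    exact hx₀ (eq_zero_of_repSpan_eq_top hK h)
  have hπne : ∃ a, π a ≠ 0 := ⟨b₀, fun h ↦ hbx₀ (by simp [h])⟩
  have hρne : ∃ b, ρ b ≠ 0 := ⟨⟨b₀, hb₀⟩, fun h ↦ hbx₀ (DFunLike.congr_fun h x₀)⟩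
  have hpure {x : H} (hx : ‖x‖ = 1) : IsPureState A (vectorFunctional π x) :=
    hπ.isPureState_vectorFunctional hπne hx
  have hcyc {x : H} (hx : ‖x‖ = 1) : x ∈ closure {y | ∃ b ∈ B, π b x = y} := by
    have hd := hρ.denseRange_orbitMap hρne (x := x) (by rintro rfl; simp at hx)
    refine closure_mono ?_ (hd x)
    rintro _ ⟨b, rfl⟩
    exact ⟨b, b.2, rfl⟩
  refine ⟨fun x hx ↦ ⟨vectorFunctional ρ x, hρ.isPureState_vectorFunctional hρne hx, fun _ ↦ rfl⟩,
    fun x y hx hy hxy a ↦ ?_, fun x hx ↦ ⟨vectorFunctional π x, fun _ ↦ rfl, hpure hx,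
      fun ψ hψ hψB ↦ hψ.1.eq_of_eqOn hBAB (hpure hx).1 hx (hcyc hx) hψB fun _ _ ↦ rfl⟩⟩
  exact DFunLike.congr_fun ((hpure hx).1.eq_of_eqOn hBAB (hpure hy).1 hx (hcyc hx)
    (fun _ _ ↦ rfl) fun b hb ↦ (hxy b hb).symm) a
end
end

section
/- Let A be a C*-algebra, let B be a nonzero hereditary C*-subalgebra of A, and let ρ be a pure state of A whose restriction to B is not identically zero. Then there exist a unique real number t ∈ (0,1] and a unique pure state ρ' of B such that ρ(b) = t·ρ'(b) for all b ∈ B. -/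
open scoped ComplexOrder InnerProductSpace

noncomputable section

variable (A : Type*) [NonUnitalNormedRing A] [NormedSpace ℂ A] [StarRing A]

variable {H : Type*} [NormedAddCommGroup H] [InnerProductSpace ℂ H] [CompleteSpace H]

open Filter Topology

section PositiveFunctional

variable {A : Type*} [NonUnitalCStarAlgebra A]

lemma ContinuousLinearMap.re_apply_le_opNorm {e : A} (h1 : ‖e‖ ≤ 1) (φ : A →L[ℂ] ℂ) :
    (φ e).re ≤ ‖φ‖ :=
  (Complex.re_le_norm _).trans (φ.unit_le_opNorm e h1)

lemma isState_inv_norm_smul {φ : A →L[ℂ] ℂ} (hφ : ∀ a, 0 ≤ φ (star a * a)) (h0 : φ ≠ 0) :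
    IsState A (‖φ‖⁻¹ • φ) :=
  ⟨fun a ↦ by simpa using smul_nonneg (inv_nonneg.mpr (norm_nonneg φ)) (hφ a), by
    rw [norm_smul, norm_inv, norm_norm, inv_mul_cancel₀ (norm_ne_zero_iff.mpr h0)]⟩

variable [PartialOrder A] [StarOrderedRing A]

/-- A bounded functional that is nonnegative on all `star a * a`, as a positive linear map. -/
def ContinuousLinearMap.toPositiveLinearMap (φ : A →L[ℂ] ℂ) (h : ∀ a, 0 ≤ φ (star a * a)) :
    A →ₚ[ℂ] ℂ :=
  .mk₀ φ fun a ha ↦ by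
    obtain ⟨b, rfl⟩ := CStarAlgebra.nonneg_iff_eq_star_mul_self.mp ha
    exact h b

namespace PositiveLinearMap

lemma norm_apply_star_mul_sq_le (f : A →ₚ[ℂ] ℂ) (a b : A) :
    ‖f (star a * b)‖ ^ 2 ≤ (f (star a * a)).re * (f (star b * b)).re := by
  have key (c : A) : ‖f.toPreGNS c‖ ^ 2 = (f (star c * c)).re := by
    have := congrArg Complex.re (f.preGNS_norm_sq (f.toPreGNS c))
    simpa [← Complex.ofReal_pow] using this
  rw [← key, ← key, ← mul_pow]
  gcongr
  simpa [preGNS_inner_def] using norm_inner_le_norm (𝕜 := ℂ) (f.toPreGNS a) (f.toPreGNS b)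

end PositiveLinearMap

lemma CStarAlgebra.mul_self_le_self_of_norm_le_one {e : A} (he : 0 ≤ e) (h1 : ‖e‖ ≤ 1) :
    e * e ≤ e := by
  obtain ⟨s, hs, hse⟩ : ∃ s : A, IsSelfAdjoint s ∧ s * s = e :=
    ⟨CFC.sqrt e, .of_nonneg (CFC.sqrt_nonneg e), CFC.sqrt_mul_sqrt_self e he⟩
  calc e * e = star s * e * s := by rw [hs.star_eq, ← hse]; simp only [mul_assoc]
    _ ≤ ‖e‖ • (star s * s) := star_left_conjugate_le_norm_smul
    _ = ‖e‖ • e := by rw [hs.star_eq, hse]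
    _ ≤ (1 : ℝ) • e := smul_le_smul_of_nonneg_right h1 he
    _ = e := one_smul _ _

namespace ContinuousLinearMap

variable {φ ψ : A →L[ℂ] ℂ}

lemma norm_apply_mul_sq_le (hφ : ∀ a, 0 ≤ φ (star a * a)) {e : A} (he : 0 ≤ e) (h1 : ‖e‖ ≤ 1)
    (a : A) : ‖φ (e * a)‖ ^ 2 ≤ (φ e).re * (φ (star a * a)).re := by
  have h := (φ.toPositiveLinearMap hφ).norm_apply_star_mul_sq_le e a
  rw [(IsSelfAdjoint.of_nonneg he).star_eq] at h
  refine h.trans (mul_le_mul_of_nonneg_right ?_ (Complex.le_def.mp (hφ a)).1)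
  exact (Complex.le_def.mp (OrderHomClass.mono (φ.toPositiveLinearMap hφ)
    (CStarAlgebra.mul_self_le_self_of_norm_le_one he h1))).1

/-- The Cauchy-Schwarz inequality against an approximate unit. -/
lemma norm_apply_sq_le (hφ : ∀ a, 0 ≤ φ (star a * a)) (a : A) :
    ‖φ a‖ ^ 2 ≤ ‖φ‖ * (φ (star a * a)).re := by
  have hl := CStarAlgebra.increasingApproximateUnit A
  have hlim : Tendsto (fun e ↦ ‖φ (e * a)‖ ^ 2) (CStarAlgebra.approximateUnit A)
      (𝓝 (‖φ a‖ ^ 2)) :=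
    (((φ.continuous.tendsto a).comp (hl.tendsto_mul_right a)).norm).pow 2
  refine le_of_tendsto hlim ?_
  filter_upwards [hl.eventually_nonneg, hl.eventually_norm] with e he h1
  exact (norm_apply_mul_sq_le hφ he h1 a).trans <|
    mul_le_mul_of_nonneg_right (re_apply_le_opNorm h1 φ) (Complex.le_def.mp (hφ a)).1

lemma tendsto_re_apply_approximateUnit (hφ : ∀ a, 0 ≤ φ (star a * a)) :
    Tendsto (fun e ↦ (φ e).re) (CStarAlgebra.approximateUnit A) (𝓝 ‖φ‖) := by
  have hl := CStarAlgebra.increasingApproximateUnit A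
  refine tendsto_order.mpr ⟨fun c hc ↦ ?_, fun c hc ↦ ?_⟩
  · have hpos {e : A} (he : 0 ≤ e) : 0 ≤ (φ e).re :=
      (Complex.le_def.mp ((φ.toPositiveLinearMap hφ).map_nonneg he)).1
    rcases lt_or_ge c 0 with h0 | h0
    · filter_upwards [hl.eventually_nonneg] with e he using h0.trans_le (hpos he)
    have hφ0 : 0 < ‖φ‖ := h0.trans_lt hc
    have hsqrt : √(c * ‖φ‖) < ‖φ‖ := by
      rw [Real.sqrt_lt' hφ0, sq]
      gcongr
    obtain ⟨a, ha, hφa⟩ := φ.exists_lt_apply_of_lt_opNorm hsqrt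
    rw [Real.sqrt_lt' ((Real.sqrt_nonneg _).trans_lt hφa)] at hφa
    have hlim : Tendsto (fun e ↦ ‖φ (e * a)‖ ^ 2) (CStarAlgebra.approximateUnit A)
        (𝓝 (‖φ a‖ ^ 2)) :=
      (((φ.continuous.tendsto a).comp (hl.tendsto_mul_right a)).norm).pow 2
    filter_upwards [hl.eventually_nonneg, hl.eventually_norm, hlim.eventually_const_lt hφa]
      with e he h1 hlt
    have ha' : ‖star a * a‖ ≤ 1 := by
      rw [CStarRing.norm_star_mul_self]
      exact mul_le_one₀ ha.le (norm_nonneg a) ha.le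
    refine lt_of_mul_lt_mul_right (hlt.trans_le ((norm_apply_mul_sq_le hφ he h1 a).trans ?_))
      hφ0.le
    exact mul_le_mul_of_nonneg_left (re_apply_le_opNorm ha' φ) (hpos he)
  · filter_upwards [hl.eventually_norm] with e h1 using (re_apply_le_opNorm h1 φ).trans_lt hc

/-- The norm is additive on positive functionals. -/
lemma norm_add_of_nonneg (hφ : ∀ a, 0 ≤ φ (star a * a)) (hψ : ∀ a, 0 ≤ ψ (star a * a)) :
    ‖φ + ψ‖ = ‖φ‖ + ‖ψ‖ :=
  tendsto_nhds_unique
    (tendsto_re_apply_approximateUnit (φ := φ + ψ) fun a ↦ by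
      simpa using add_nonneg (hφ a) (hψ a))
    (by simpa using (tendsto_re_apply_approximateUnit hφ).add (tendsto_re_apply_approximateUnit hψ))

end ContinuousLinearMap

/-- A positive functional dominated by a pure state is a multiple of it. -/
lemma IsPureState.eq_norm_smul_of_le {ρ ψ : A →L[ℂ] ℂ} (hρ : IsPureState A ρ)
    (hψ : ∀ a, 0 ≤ ψ (star a * a)) (hle : ∀ a, ψ (star a * a) ≤ ρ (star a * a)) :
    ψ = ‖ψ‖ • ρ := by
  rcases eq_or_ne ψ 0 with rfl | h0
  · rw [norm_zero]
    exact (zero_smul ℝ ρ).symm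
  have hd (a : A) : 0 ≤ (ρ - ψ) (star a * a) := by simpa using hle a
  have hadd : ‖ψ‖ + ‖ρ - ψ‖ = 1 := by
    rw [← ContinuousLinearMap.norm_add_of_nonneg hψ hd, add_sub_cancel, hρ.1.2]
  rcases eq_or_ne (ρ - ψ) 0 with h1 | h1
  · rw [h1, norm_zero, add_zero] at hadd
    rw [hadd, one_smul, sub_eq_zero.mp h1]
  have hseg : ρ ∈ openSegment ℝ (‖ψ‖⁻¹ • ψ) (‖ρ - ψ‖⁻¹ • (ρ - ψ)) :=
    ⟨‖ψ‖, ‖ρ - ψ‖, norm_pos_iff.mpr h0, norm_pos_iff.mpr h1, hadd, by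
      rw [smul_inv_smul₀ (norm_ne_zero_iff.mpr h0), smul_inv_smul₀ (norm_ne_zero_iff.mpr h1),
        add_sub_cancel]⟩
  rw [← hρ.2 (isState_inv_norm_smul hψ h0) (isState_inv_norm_smul hd h1) hseg,
    smul_inv_smul₀ (norm_ne_zero_iff.mpr h0)]

end PositiveFunctional

universe u

section Unordered

variable {A : Type*} [NonUnitalCStarAlgebra A]

lemma ContinuousLinearMap.map_star_of_nonneg {φ : A →L[ℂ] ℂ} (hφ : ∀ a, 0 ≤ φ (star a * a))
    (a : A) : φ (star a) = star (φ a) := by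
  let := CStarAlgebra.spectralOrder A
  have := CStarAlgebra.spectralOrderedRing A
  exact map_star (φ.toPositiveLinearMap hφ) a

lemma LinearMap.ext_star_mul_self {φ ψ : A →ₗ[ℂ] ℂ}
    (h : ∀ a, φ (star a * a) = ψ (star a * a)) : φ = ψ := by
  let := CStarAlgebra.spectralOrder A
  have := CStarAlgebra.spectralOrderedRing A
  refine LinearMap.ext_on (CStarAlgebra.span_nonneg (A := A)) fun a ha ↦ ?_
  obtain ⟨b, rfl⟩ := CStarAlgebra.nonneg_iff_eq_star_mul_self.mp (show 0 ≤ a from ha)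
  exact h b

end Unordered

/-- The Hilbert space obtained by separating and completing a semi-inner product space. -/
lemma exists_hilbertSpace_of_core {V : Type u} [AddCommGroup V] [Module ℂ V]
    (c : PreInnerProductSpace.Core ℂ V) :
    ∃ (F : Type u) (_ : NormedAddCommGroup F) (_ : InnerProductSpace ℂ F) (_ : CompleteSpace F)
      (j : V →ₗ[ℂ] F), ∀ x y, ⟪j x, j y⟫_ℂ = c.inner x y := by
  let : SeminormedAddCommGroup V := InnerProductSpace.Core.toSeminormedAddCommGroup (c := c)
  let : InnerProductSpace ℂ V := InnerProductSpace.ofCore c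
  exact ⟨UniformSpace.Completion V, inferInstance, inferInstance, inferInstance,
    (UniformSpace.Completion.toComplL (𝕜 := ℂ) (E := V)).toLinearMap,
    fun x y ↦ UniformSpace.Completion.inner_coe x y⟩

/-- The GNS representation of a positive functional, with its cyclic vector. -/
lemma exists_gns_cyclic {A : Type u} [NonUnitalCStarAlgebra A] [PartialOrder A] [StarOrderedRing A]
    {ρ : A →L[ℂ] ℂ} (hρ : ∀ a, 0 ≤ ρ (star a * a)) :
    ∃ (H : Type u) (_ : NormedAddCommGroup H) (_ : InnerProductSpace ℂ H) (_ : CompleteSpace H)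
      (π : A →⋆ₙₐ[ℂ] (H →L[ℂ] H)) (ξ : H), ∀ a b, ⟪π a ξ, π b ξ⟫_ℂ = ρ (star a * b) := by
  let f := ρ.toPositiveLinearMap hρ
  let ι : A →ₗ[ℂ] f.GNS :=
    (UniformSpace.Completion.toComplL (𝕜 := ℂ) (E := f.PreGNS)).toLinearMap ∘ₗ
      f.toPreGNS.toLinearMap
  have hι (a b : A) : ⟪ι a, ι b⟫_ℂ = ρ (star a * b) :=
    UniformSpace.Completion.inner_coe (f.toPreGNS a) (f.toPreGNS b)
  have hdense : DenseRange ι :=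
    UniformSpace.Completion.denseRange_coe.comp f.toPreGNS.surjective.denseRange
      (UniformSpace.Completion.continuous_coe _)
  have hbound (a : A) : ‖(ρ : A →ₗ[ℂ] ℂ) a‖ ≤ √‖ρ‖ * ‖ι a‖ := by
    have hsq : ‖ι a‖ ^ 2 = (ρ (star a * a)).re := by
      rw [← hι, inner_self_eq_norm_sq_to_K]
      norm_cast
    refine (sq_le_sq₀ (norm_nonneg _) (by positivity)).mp ?_
    rw [mul_pow, Real.sq_sqrt (norm_nonneg ρ), hsq]
    exact ContinuousLinearMap.norm_apply_sq_le hρ a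
  let g := (ρ : A →ₗ[ℂ] ℂ).extendOfNorm ι
  have hg (a : A) : g (ι a) = ρ a := LinearMap.extendOfNorm_eq hdense ⟨_, hbound⟩ a
  let ξ := (InnerProductSpace.toDual ℂ f.GNS).symm g
  have hξ (a : A) : ⟪ξ, ι a⟫_ℂ = ρ a := by
    rw [InnerProductSpace.toDual_symm_apply, hg]
  have hπ (a b : A) : f.gnsNonUnitalStarAlgHom a (ι b) = ι (a * b) :=
    f.gnsNonUnitalStarAlgHom_apply_coe
  have hcyc (a : A) : f.gnsNonUnitalStarAlgHom a ξ = ι a := by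
    refine hdense.eq_of_inner_left ℂ fun b ↦ ?_
    rw [← ContinuousLinearMap.adjoint_inner_right, ← ContinuousLinearMap.star_eq_adjoint,
      ← map_star, hπ, hξ, hι]
  exact ⟨f.GNS, inferInstance, inferInstance, inferInstance, f.gnsNonUnitalStarAlgHom, ξ,
    fun a b ↦ by rw [hcyc, hcyc, hι]⟩

namespace IsHereditary

variable {A : Type*} [NonUnitalCStarAlgebra A] [PartialOrder A] [StarOrderedRing A]
  {B : NonUnitalStarSubalgebra ℂ A}

/-- The left ideal `{x | star x * x ∈ B}` attached to a hereditary subalgebra `B`. -/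
def leftIdeal (hB : IsHereditary A B) : Submodule ℂ A where
  carrier := {x | star x * x ∈ B}
  zero_mem' := by simp
  add_mem' {x y} hx hy := by
    refine hB.2 _ ((2 : ℂ) • (star x * x + star y * y)) (SMulMemClass.smul_mem 2 (add_mem hx hy))
      (star_mul_self_nonneg _) (sub_nonneg.mp ?_)
    convert star_mul_self_nonneg (x - y) using 1
    simp only [star_add, star_sub, add_mul, mul_add, sub_mul, mul_sub, two_smul]
    abel
  smul_mem' c x hx := by
    have := SMulMemClass.smul_mem (star c * c) (show star x * x ∈ B from hx)
    simpa only [Set.mem_ofPred_eq, star_smul, smul_mul_smul_comm] using this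

lemma mem_leftIdeal {hB : IsHereditary A B} {x : A} : x ∈ hB.leftIdeal ↔ star x * x ∈ B := Iff.rfl

lemma mem_leftIdeal_of_mem (hB : IsHereditary A B) {b : A} (hb : b ∈ B) : b ∈ hB.leftIdeal :=
  mul_mem (star_mem hb) hb

lemma mul_mem_leftIdeal (hB : IsHereditary A B) (a : A) {x : A} (hx : x ∈ hB.leftIdeal) :
    a * x ∈ hB.leftIdeal := by
  refine hB.2 _ (((‖star a * a‖ : ℝ) : ℂ) • (star x * x)) (SMulMemClass.smul_mem _ hx)
    (star_mul_self_nonneg _) ?_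
  rw [star_mul, mul_assoc, ← mul_assoc (star a), ← mul_assoc, Complex.coe_smul]
  exact CStarAlgebra.star_left_conjugate_le_norm_smul

lemma star_mul_mem (hB : IsHereditary A B) {x y : A} (hy : y ∈ hB.leftIdeal)
    (hx : x ∈ hB.leftIdeal) : star y * x ∈ B := by
  have h (c : ℂ) : c • (star x * y) + star c • (star y * x) ∈ B := by
    have h1 : star (x + c • y) * (x + c • y) ∈ B :=
      hB.leftIdeal.add_mem hx (hB.leftIdeal.smul_mem c hy)
    have h2 : star (c • y) * (c • y) ∈ B := hB.leftIdeal.smul_mem c hy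
    convert sub_mem (sub_mem h1 (mem_leftIdeal.mp hx)) h2 using 1
    simp only [star_add, star_smul, add_mul, mul_add, smul_add, smul_mul_assoc, mul_smul_comm]
    abel
  convert SMulMemClass.smul_mem (1 / 2 : ℂ)
    (add_mem (h 1) (SMulMemClass.smul_mem Complex.I (h Complex.I))) using 1
  simp only [smul_add, smul_smul, star_one, Complex.star_def, Complex.conj_I]
  ring_nf
  simp
  module

lemma exists_star_mul_self_eq (hB : IsHereditary A B) {x : A} (hx : x ∈ hB.leftIdeal) :
    ∃ c : B, star (c : A) * c = star x * x := by
  have := hB.1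
  refine ⟨⟨CFC.sqrt (star x * x), ?_⟩, ?_⟩
  · rw [CFC.sqrt_eq_real_sqrt _ (star_mul_self_nonneg x)]
    exact cfcₙ_mem (𝕜' := ℂ) _ hx
  · rw [(IsSelfAdjoint.of_nonneg (CFC.sqrt_nonneg (star x * x))).star_eq,
      CFC.sqrt_mul_sqrt_self _ (star_mul_self_nonneg x)]

end IsHereditary

namespace IsHereditary

variable {A : Type*} [NonUnitalCStarAlgebra A] [PartialOrder A] [StarOrderedRing A]
  {B : NonUnitalStarSubalgebra ℂ A}

/-- The semi-inner product `⟪y, x⟫ = φ (star y * x)` on the left ideal of `B`. -/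
abbrev core (hB : IsHereditary A B) {φ : B →L[ℂ] ℂ} (hφ : ∀ b, 0 ≤ φ (star b * b)) :
    PreInnerProductSpace.Core ℂ hB.leftIdeal where
  inner y x := φ ⟨star (y : A) * x, hB.star_mul_mem y.2 x.2⟩
  conj_inner_symm y x := by
    have := hB.1
    rw [starRingEnd_apply, ← φ.map_star_of_nonneg hφ]
    congr 1
    ext
    simp
  re_inner_nonneg x := by
    obtain ⟨c, hc⟩ := hB.exists_star_mul_self_eq x.2
    rw [show (⟨star (x : A) * x, hB.star_mul_mem x.2 x.2⟩ : B) = star c * c from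
      Subtype.ext hc.symm]
    exact (Complex.le_def.mp (hφ c)).1
  add_left x y z := by
    rw [← map_add]
    congr 1
    ext
    simp [add_mul]
  smul_left x y r := by
    refine Eq.trans (congrArg φ (Subtype.ext ?_)) (map_smul φ (starRingEnd ℂ r) _)
    simp [smul_mul_assoc]

/-- A positive functional on a hereditary subalgebra that is dominated by the restriction of a
positive functional `ρ` extends to a positive functional dominated by `ρ`. -/
theorem exists_extension_le (hB : IsHereditary A B) {ρ : A →L[ℂ] ℂ}
    (hρ : ∀ a, 0 ≤ ρ (star a * a)) {φ : B →L[ℂ] ℂ} (hφ : ∀ b, 0 ≤ φ (star b * b))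
    (hle : ∀ b : B, φ (star b * b) ≤ ρ (star (b : A) * b)) :
    ∃ ψ : A →L[ℂ] ℂ, (∀ a, 0 ≤ ψ (star a * a)) ∧ (∀ a, ψ (star a * a) ≤ ρ (star a * a)) ∧
      ∀ b : B, ψ b = φ b := by
  have := hB.1
  obtain ⟨H, _, _, _, π, ξ, hπ⟩ := exists_gns_cyclic hρ
  obtain ⟨F, _, _, _, j, hj⟩ := exists_hilbertSpace_of_core (hB.core hφ)
  replace hj (y x : hB.leftIdeal) :
      ⟪j y, j x⟫_ℂ = φ ⟨star (y : A) * x, hB.star_mul_mem y.2 x.2⟩ := hj y x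
  have hadj (a : A) (u v : H) : ⟪u, π a v⟫_ℂ = ⟪π (star a) u, v⟫_ℂ := by
    rw [map_star, ContinuousLinearMap.star_eq_adjoint, ContinuousLinearMap.adjoint_inner_left]
  let ev : A →ₗ[ℂ] H :=
    { toFun a := π a ξ, map_add' := by simp, map_smul' := by simp }
  let N : Submodule ℂ H := hB.leftIdeal.map ev
  let K := N.topologicalClosure
  have hKc : IsClosed (K : Set H) := N.isClosed_topologicalClosure
  have : CompleteSpace K := hKc.completeSpace_coe
  have hNK : N ≤ K := N.le_topologicalClosure
  let e : hB.leftIdeal →ₗ[ℂ] K := (ev.domRestrict hB.leftIdeal).codRestrict K fun x ↦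
    hNK ⟨x, x.2, rfl⟩
  have he (x : hB.leftIdeal) : (e x : H) = π (x : A) ξ := rfl
  have hdense : DenseRange e := by
    intro u
    rw [closure_subtype]
    refine closure_mono ?_ u.2
    rintro _ ⟨x, hx, rfl⟩
    exact ⟨e ⟨x, hx⟩, ⟨_, rfl⟩, rfl⟩
  have hnorm (x : hB.leftIdeal) : ‖j x‖ ≤ 1 * ‖e x‖ := by
    obtain ⟨c, hc⟩ := hB.exists_star_mul_self_eq x.2
    rw [one_mul, ← sq_le_sq₀ (norm_nonneg _) (norm_nonneg _), ← Complex.real_le_real]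
    have h1 : ((‖j x‖ ^ 2 : ℝ) : ℂ) = φ (star c * c) := by
      rw [Complex.ofReal_pow]
      refine (inner_self_eq_norm_sq_to_K (𝕜 := ℂ) (j x)).symm.trans ((hj x x).trans ?_)
      exact congrArg φ (Subtype.ext hc.symm)
    have h2 : ((‖e x‖ ^ 2 : ℝ) : ℂ) = ρ (star (c : A) * c) := by
      rw [Complex.ofReal_pow, hc]
      exact (inner_self_eq_norm_sq_to_K (𝕜 := ℂ) (π (x : A) ξ)).symm.trans (hπ _ _)
    rw [h1, h2]
    exact hle c
  let S₀ : K →L[ℂ] F := j.extendOfNorm e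
  let S : H →L[ℂ] F := S₀ ∘L K.orthogonalProjectionOnto
  have hSnorm (u : H) : ‖S u‖ ≤ ‖u‖ :=
    (LinearMap.norm_extendOfNorm_apply_le hdense 1 hnorm _).trans <| by
      rw [one_mul]
      exact K.norm_orthogonalProjectionOnto_apply_le u
  have hSj (x : hB.leftIdeal) : S (π (x : A) ξ) = j x := by
    rw [← he, ContinuousLinearMap.comp_apply, K.orthogonalProjectionOnto_mem_subspace_eq_self]
    exact LinearMap.extendOfNorm_eq hdense ⟨1, hnorm⟩ x
  have hSperp {u : H} (hu : u ∈ Kᗮ) : S u = 0 := by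
    rw [ContinuousLinearMap.comp_apply,
      K.orthogonalProjectionOnto_apply_of_mem_orthogonal hu, map_zero]
  have hKinv (a : A) {u : H} (hu : u ∈ K) : π a u ∈ K := by
    refine map_mem_closure (π a).continuous hu ?_
    rintro _ ⟨x, hx, rfl⟩
    exact ⟨a * x, hB.mul_mem_leftIdeal a hx, by simp [ev]⟩
  have hperpinv (a : A) {u : H} (hu : u ∈ Kᗮ) : π a u ∈ Kᗮ := fun w hw ↦ by
    rw [hadj]
    exact hu _ (hKinv _ hw)
  have hSproj (a : A) (u : H) : S (π a u) = S (π a (K.orthogonalProjectionOnto u)) := by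
    rw [← sub_eq_zero, ← map_sub, ← map_sub]
    exact hSperp (hperpinv a (K.sub_starProjection_mem_orthogonal u))
  have hSself (u : H) : S u = S (K.orthogonalProjectionOnto u) := by
    rw [← sub_eq_zero, ← map_sub]
    exact hSperp (K.sub_starProjection_mem_orthogonal u)
  have hSadjK (a : A) (u v : K) : ⟪S u, S (π a v)⟫_ℂ = ⟪S (π (star a) u), S v⟫_ℂ := by
    refine hdense.induction_on₂ (p := fun u v : K ↦
      ⟪S u, S (π a v)⟫_ℂ = ⟪S (π (star a) u), S v⟫_ℂ) ?_ ?_ u v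
    · apply isClosed_eq <;> fun_prop
    · intro y x
      have hmul (b : A) (z : hB.leftIdeal) :
          S (π b (e z)) = j ⟨b * z, hB.mul_mem_leftIdeal b z.2⟩ := by
        rw [← hSj, he, map_mul, mul_apply_eq_comp]
      rw [hmul, hmul, he, he, hSj, hSj, hj, hj]
      simp only [star_mul, star_star, mul_assoc]
  have hSadj (a : A) (u v : H) : ⟪S u, S (π a v)⟫_ℂ = ⟪S (π (star a) u), S v⟫_ℂ := by
    rw [hSself u, hSproj a v, hSproj (star a) u, hSself v, hSadjK]
  let ψ : A →L[ℂ] ℂ := LinearMap.mkContinuous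
    ((innerSL ℂ (S ξ) ∘L S).toLinearMap ∘ₗ ev) (‖innerSL ℂ (S ξ) ∘L S‖ * ‖ξ‖) fun a ↦ by
      refine ((innerSL ℂ (S ξ) ∘L S).le_opNorm (π a ξ)).trans ?_
      rw [mul_assoc, mul_comm ‖ξ‖]
      gcongr
      exact (π a).le_of_opNorm_le (NonUnitalStarAlgHom.norm_apply_le π a) ξ
  have hψ (a b : A) : ψ (star a * b) = ⟪S (π a ξ), S (π b ξ)⟫_ℂ := by
    change ⟪S ξ, S (π (star a * b) ξ)⟫_ℂ = _
    rw [map_mul, mul_apply_eq_comp, hSadj, star_star]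
  have hψsq (a : A) : ψ (star a * a) = ((‖S (π a ξ)‖ ^ 2 : ℝ) : ℂ) := by
    rw [hψ, Complex.ofReal_pow]
    exact inner_self_eq_norm_sq_to_K _
  refine ⟨ψ, fun a ↦ ?_, fun a ↦ ?_, ?_⟩
  · rw [hψsq, Complex.zero_le_real]
    positivity
  · rw [hψsq, ← hπ]
    refine le_of_le_of_eq (Complex.real_le_real.mpr
      (pow_le_pow_left₀ (norm_nonneg _) (hSnorm (π a ξ)) 2)) ?_
    rw [Complex.ofReal_pow]
    exact (inner_self_eq_norm_sq_to_K (𝕜 := ℂ) (π a ξ)).symm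
  · refine LinearMap.congr_fun (LinearMap.ext_star_mul_self (A := B)
      (φ := ψ.toLinearMap ∘ₗ B.toSubmodule.subtype) (ψ := φ.toLinearMap) fun b ↦ ?_)
    have hb := hB.mem_leftIdeal_of_mem b.2
    change ψ (star (b : A) * b) = φ (star b * b)
    rw [hψ, hSj ⟨b, hb⟩, hj]
    rfl

end IsHereditary

/-- A nonzero positive functional of norm at most one is a multiple of a unique pure state, provided
that every positive functional it dominates is proportional to it. -/
theorem existsUnique_isPureState_of_forall_le {C : Type*} [NonUnitalCStarAlgebra C]
    {r : C →L[ℂ] ℂ} (hrpos : ∀ b, 0 ≤ r (star b * b)) (hr0 : r ≠ 0) (hr1 : ‖r‖ ≤ 1)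
    (hr : ∀ φ : C →L[ℂ] ℂ, (∀ b, 0 ≤ φ (star b * b)) → (∀ b, φ (star b * b) ≤ r (star b * b)) →
      ∃ c : ℝ, 0 ≤ c ∧ φ = c • r) :
    ∃! p : ℝ × (C →L[ℂ] ℂ),
      (0 < p.1 ∧ p.1 ≤ 1) ∧ IsPureState C p.2 ∧ ∀ b, r b = (p.1 : ℂ) * p.2 b := by
  have ht : 0 < ‖r‖ := norm_pos_iff.mpr hr0
  have hstate := isState_inv_norm_smul hrpos hr0
  refine ⟨(‖r‖, ‖r‖⁻¹ • r), ⟨⟨ht, hr1⟩, ⟨hstate, ?_⟩, fun b ↦ ?_⟩, ?_⟩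
  · rintro φ₁ ⟨h₁, hn₁⟩ φ₂ ⟨h₂, -⟩ ⟨s, s', hs, hs', -, hseg⟩
    have hsplit : (‖r‖ * s) • φ₁ + (‖r‖ * s') • φ₂ = r := by
      refine Eq.trans ?_ ((congrArg (‖r‖ • ·) hseg).trans (smul_inv_smul₀ ht.ne' r))
      ext b
      simp
      ring
    have hpos₁ (b : C) : 0 ≤ ((‖r‖ * s) • φ₁) (star b * b) :=
      smul_nonneg (mul_pos ht hs).le (h₁ b)
    have hpos₂ (b : C) : 0 ≤ ((‖r‖ * s') • φ₂) (star b * b) :=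
      smul_nonneg (mul_pos ht hs').le (h₂ b)
    obtain ⟨c, hc, hφ₁⟩ := hr _ hpos₁ fun b ↦
      (le_add_of_nonneg_right (hpos₂ b)).trans_eq
        (congrArg (fun f : C →L[ℂ] ℂ ↦ f (star b * b)) hsplit)
    have hnorm := congrArg norm hφ₁
    rw [norm_smul, norm_smul, hn₁, mul_one, Real.norm_of_nonneg hc,
      Real.norm_of_nonneg (mul_pos ht hs).le, mul_comm, mul_left_inj' ht.ne'] at hnorm
    rw [← hnorm, mul_comm, mul_smul] at hφ₁
    rw [eq_inv_smul_iff₀ ht.ne']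
    exact smul_right_injective _ hs.ne' hφ₁
  · simp [ht.ne']
  · rintro ⟨t, f⟩ ⟨⟨h0, -⟩, hf, heq⟩
    have hrf : r = t • f := by
      ext b
      simpa using heq b
    have hnt : ‖r‖ = t := by
      rw [hrf, norm_smul, hf.1.2, mul_one, Real.norm_of_nonneg h0.le]
    rw [hnt, hrf, inv_smul_smul₀ h0.ne']

theorem IsHereditary.existsUnique_isPureState {A : Type*} [NonUnitalCStarAlgebra A]
    [PartialOrder A] [StarOrderedRing A] {B : NonUnitalStarSubalgebra ℂ A} (hB : IsHereditary A B)
    {ρ : A →L[ℂ] ℂ} (hρ : IsPureState A ρ) (hρB : ∃ b ∈ B, ρ b ≠ 0) :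
    ∃! p : ℝ × (↥B →L[ℂ] ℂ),
      (0 < p.1 ∧ p.1 ≤ 1) ∧ IsPureState ↥B p.2 ∧
        ∀ b : ↥B, ρ (b : A) = (p.1 : ℂ) * p.2 b := by
  have := hB.1
  let r : B →L[ℂ] ℂ := ρ ∘L B.toSubmodule.subtypeL
  refine existsUnique_isPureState_of_forall_le (r := r) (fun b ↦ hρ.1.1 b) ?_ ?_ fun φ hφ hle ↦ ?_
  · obtain ⟨b, hb, hb0⟩ := hρB
    exact fun h ↦ hb0 (congrArg (fun f : B →L[ℂ] ℂ ↦ f ⟨b, hb⟩) h)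
  · exact r.opNorm_le_bound zero_le_one fun b ↦ (ρ.le_opNorm b).trans_eq (by rw [hρ.1.2]; rfl)
  · obtain ⟨ψ, hψ0, hψ1, hψ⟩ := hB.exists_extension_le hρ.1.1 hφ hle
    refine ⟨‖ψ‖, norm_nonneg ψ, ?_⟩
    ext b
    rw [← hψ b]
    exact congrArg (fun f : A →L[ℂ] ℂ ↦ f b) (hρ.eq_norm_smul_of_le hψ0 hψ1)

/-- If `ρ` is a pure state of `A` not vanishing identically on a nonzero hereditary
C*-subalgebra `B`, then there are a unique `t ∈ (0,1]` and a unique pure state `ρ'`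
of `B` with `ρ = t·ρ'` on `B`. -/
theorem restriction_of_pure_state_to_hereditary
    {A : Type*} [NonUnitalNormedRing A] [NormedSpace ℂ A] [StarRing A]
    [CStarRing A] [CompleteSpace A] [IsScalarTower ℂ A A] [SMulCommClass ℂ A A]
    [StarModule ℂ A] [PartialOrder A] [StarOrderedRing A]
    (B : NonUnitalStarSubalgebra ℂ A) (hB : IsHereditary A B)
    (hBne : ∃ b ∈ B, b ≠ (0 : A))
    (ρ : A →L[ℂ] ℂ) (hρ : IsPureState A ρ) (hρB : ∃ b ∈ B, ρ b ≠ 0) :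
    ∃! p : ℝ × (↥B →L[ℂ] ℂ),
      (0 < p.1 ∧ p.1 ≤ 1) ∧ IsPureState ↥B p.2 ∧
        ∀ b : ↥B, ρ (b : A) = (p.1 : ℂ) * p.2 b := by
  let : NonUnitalCStarAlgebra A := { }
  exact hB.existsUnique_isPureState hρ hρB
end
end

section
/- Let A be a C*-algebra and let I be a closed two-sided ideal of A. Then I equals the intersection of the kernels of all irreducible representations π of A with I ⊆ ker π (this intersection taken to be A if there is no such representation). Consequently, if I and J are closed two-sided ideals of A such that an irreducible representation of A annihilates I exactly when it annihilates J, then I = J. -/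
open scoped ComplexOrder InnerProductSpace

noncomputable section

variable (A : Type*) [NonUnitalNormedRing A] [NormedSpace ℂ A] [StarRing A]

variable {H : Type*} [NormedAddCommGroup H] [InnerProductSpace ℂ H] [CompleteSpace H]

/-- A closed two-sided ideal: a norm-closed subspace `I` with `AI ⊆ I` and `IA ⊆ I`. -/
def IsClosedTwoSidedIdeal {A : Type*} [NonUnitalNormedRing A] [NormedSpace ℂ A]
    (I : Submodule ℂ A) : Prop :=
  IsClosed (I : Set A) ∧ (∀ a x : A, x ∈ I → a * x ∈ I) ∧ ∀ a x : A, x ∈ I → x * a ∈ I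

universe u

section UnitalIdeals

variable {B : Type*} [CStarAlgebra B]

/-- In a closed ideal one finds self-adjoint contractions `v`, congruent to `1` modulo the ideal,
such that `j * v` is small. -/
theorem IsClosedTwoSidedIdeal.exists_norm_mul_le {J : Submodule ℂ B}
    (hJ : IsClosedTwoSidedIdeal J) {j : B} (hj : j ∈ J) {ε : ℝ} (hε : 0 < ε) :
    ∃ v : B, IsSelfAdjoint v ∧ ‖v‖ ≤ 1 ∧ 1 - v ∈ J ∧ ‖j * v‖ ≤ ε := by
  let _ : PartialOrder B := CStarAlgebra.spectralOrder B
  let _ : StarOrderedRing B := CStarAlgebra.spectralOrderedRing B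
  set x : B := star j * j with hx
  have hx0 : 0 ≤ x := star_mul_self_nonneg j
  have hxJ : x ∈ J := hJ.2.1 _ _ hj
  have hsp : ∀ t ∈ spectrum ℝ x, 0 ≤ t := fun t ht => spectrum_nonneg_of_nonneg hx0 ht
  set c : ℝ := (ε ^ 2)⁻¹ with hc
  have hc0 : 0 < c := by positivity
  set g : ℝ → ℝ := fun t => (1 + c * t)⁻¹ with hg
  have hpos : ∀ t ∈ spectrum ℝ x, 0 < 1 + c * t := fun t ht => by
    have := mul_nonneg hc0.le (hsp t ht)
    linarith
  have hcont : ContinuousOn g (spectrum ℝ x) :=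
    ContinuousOn.inv₀ (by fun_prop) fun t ht => (hpos t ht).ne'
  have hsa : IsSelfAdjoint (cfc g x) := cfc_predicate g x
  have hmul : cfc (fun t => g t * t) x = cfc g x * x := by
    rw [cfc_mul g (fun t : ℝ => t) x, cfc_id' ℝ x]
  refine ⟨cfc g x, hsa, ?_, ?_, ?_⟩
  · refine norm_cfc_le zero_le_one fun t ht => ?_
    rw [Real.norm_of_nonneg (inv_nonneg.2 (hpos t ht).le)]
    exact inv_le_one_of_one_le₀ (by nlinarith [hsp t ht])
  · have h1 : 1 - cfc g x = ((c : ℂ) • cfc g x) * x := by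
      have e1 : (1 : B) = cfc (fun t => (1 + c * t) * g t) x := by
        rw [← cfc_const_one ℝ x]
        exact cfc_congr fun t ht => (mul_inv_cancel₀ (hpos t ht).ne').symm
      have e2 : cfc (fun t => (1 + c * t) * g t) x = cfc g x + c • (cfc g x * x) := by
        rw [← hmul, ← cfc_smul c (fun t => g t * t) x,
          ← cfc_add x g (fun t => c • (g t * t))]
        refine cfc_congr fun t _ => ?_
        simp only [smul_eq_mul]
        ring
      rw [e1, e2, add_sub_cancel_left, smul_mul_assoc, Complex.coe_smul]
    rw [h1]
    exact hJ.2.1 _ _ hxJ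
  · have h2 : ‖j * cfc g x‖ ^ 2 ≤ ε ^ 2 := by
      rw [sq, ← CStarRing.norm_star_mul_self, star_mul, hsa.star_eq,
        show cfc g x * star j * (j * cfc g x) = cfc g x * x * cfc g x by
          simp only [hx, mul_assoc]]
      have e3 : cfc g x * x * cfc g x = cfc (fun t => g t * t * g t) x := by
        rw [cfc_mul (fun t => g t * t) g x, hmul]
      rw [e3]
      refine norm_cfc_le (by positivity) fun t ht => ?_
      have ht0 := hsp t ht
      have hp := hpos t ht
      rw [Real.norm_of_nonneg (by positivity)]
      have hce : c * ε ^ 2 = 1 := inv_mul_cancel₀ (by positivity)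
      have : g t * t * g t = t / (1 + c * t) ^ 2 := by
        simp only [hg]; field_simp
      rw [this, div_le_iff₀ (by positivity)]
      have h5 : ε ^ 2 * (1 + c * t) ^ 2 = ε ^ 2 + 2 * t + ε ^ 2 * (c * t) ^ 2 := by
        linear_combination (2 * t) * hce
      rw [h5]
      nlinarith [sq_nonneg ε, mul_nonneg (sq_nonneg ε) (sq_nonneg (c * t))]
    exact (sq_le_sq₀ (norm_nonneg _) hε.le).1 h2

/-- A closed two-sided ideal contains the points arbitrarily well approximated by the ideal. -/
theorem IsClosedTwoSidedIdeal.mem_of_forall_exists {J : Submodule ℂ B}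
    (hJ : IsClosedTwoSidedIdeal J) {a : B}
    (h : ∀ ε > 0, ∃ y ∈ J, ‖a - y‖ ≤ ε) : a ∈ J := by
  refine hJ.1.closure_subset (Metric.mem_closure_iff.2 fun ε hε => ?_)
  obtain ⟨y, hy, hle⟩ := h (ε / 2) (half_pos hε)
  exact ⟨y, hy, by rw [dist_eq_norm]; linarith⟩

theorem IsClosedTwoSidedIdeal.star_mem {J : Submodule ℂ B}
    (hJ : IsClosedTwoSidedIdeal J) {j : B} (hj : j ∈ J) : star j ∈ J := by
  refine hJ.mem_of_forall_exists fun ε hε => ?_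
  obtain ⟨v, hv, -, hvJ, hle⟩ := hJ.exists_norm_mul_le hj hε
  refine ⟨(1 - v) * star j, hJ.2.2 _ _ hvJ, ?_⟩
  rw [sub_mul, one_mul, sub_sub_cancel, ← norm_star, star_mul, star_star, hv.star_eq]
  exact hle

variable [PartialOrder B] [StarOrderedRing B]

/-- If `a* a` is dominated, up to arbitrarily small errors, by elements of a closed two-sided
ideal, then `a` belongs to the ideal. -/
theorem IsClosedTwoSidedIdeal.mem_of_star_mul_self_le {J : Submodule ℂ B}
    (hJ : IsClosedTwoSidedIdeal J) {a : B}
    (h : ∀ ε : ℝ, 0 < ε → ∃ j ∈ J, star a * a ≤ j + algebraMap ℝ B ε) : a ∈ J := by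
  refine hJ.mem_of_forall_exists fun ε hε => ?_
  obtain ⟨j, hj, hle⟩ := h (ε ^ 2 / 2) (by positivity)
  obtain ⟨v, hv, hv1, hvJ, hjv⟩ := hJ.exists_norm_mul_le hj (ε := ε ^ 2 / 2) (by positivity)
  refine ⟨a * (1 - v), hJ.2.1 _ _ hvJ, ?_⟩
  rw [mul_sub, mul_one, sub_sub_cancel, ← sq_le_sq₀ (norm_nonneg _) hε.le, sq ‖a * v‖,
    ← CStarRing.norm_star_mul_self, star_mul,
    show star v * star a * (a * v) = star v * (star a * a) * v by simp only [mul_assoc]]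
  have hconj := star_left_conjugate_le_conjugate hle v
  have h0 : 0 ≤ star v * (star a * a) * v :=
    star_left_conjugate_nonneg (star_mul_self_nonneg a) v
  refine (CStarAlgebra.norm_le_norm_of_nonneg_of_le h0 hconj).trans ?_
  have hmul : star v * (j + algebraMap ℝ B (ε ^ 2 / 2)) * v
      = star v * (j * v) + (ε ^ 2 / 2) • (star v * v) := by
    rw [Algebra.algebraMap_eq_smul_one, mul_add, add_mul, mul_assoc, mul_smul_comm, mul_one,
      smul_mul_assoc]
  rw [hmul]
  have n1 : ‖star v * (j * v)‖ ≤ ε ^ 2 / 2 := by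
    refine (norm_mul_le _ _).trans ?_
    rw [norm_star]
    exact (mul_le_of_le_one_left (norm_nonneg _) hv1).trans hjv
  have n2 : ‖(ε ^ 2 / 2) • (star v * v)‖ ≤ ε ^ 2 / 2 := by
    rw [norm_smul, CStarRing.norm_star_mul_self, Real.norm_of_nonneg (by positivity)]
    exact mul_le_of_le_one_right (by positivity) (mul_le_one₀ hv1 (norm_nonneg _) hv1)
  linarith [norm_add_le (star v * (j * v)) ((ε ^ 2 / 2) • (star v * v))]

end UnitalIdeals

theorem isClosed_setOf_weakDual_eq_zero {E : Type*} [NormedAddCommGroup E] [NormedSpace ℂ E]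
    (x : E) : IsClosed {g : WeakDual ℂ E | g x = 0} :=
  isClosed_eq (WeakDual.eval_continuous _) continuous_const

theorem convex_setOf_weakDual_eq_zero {E : Type*} [NormedAddCommGroup E] [NormedSpace ℂ E]
    (x : E) : Convex ℝ {g : WeakDual ℂ E | g x = 0} := by
  intro g hg k hk s t _ _ _
  change s • g x + t • k x = 0
  rw [show g x = 0 from hg, show k x = 0 from hk, smul_zero, smul_zero, add_zero]

theorem closure_convexHull_subset_setOf_weakDual_eq_zero {E : Type*} [NormedAddCommGroup E]
    [NormedSpace ℂ E] {S : Set (WeakDual ℂ E)} {x : E} (h : ∀ g ∈ S, g x = 0) :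
    closure (convexHull ℝ S) ⊆ {g : WeakDual ℂ E | g x = 0} :=
  closure_minimal (convexHull_min (𝕜 := ℝ) h (convex_setOf_weakDual_eq_zero x))
    (isClosed_setOf_weakDual_eq_zero x)

/-- The **Krein–Milman theorem** for the weak-* topology. -/
theorem closure_convexHull_extremePoints_weakDual {E : Type*} [NormedAddCommGroup E]
    [NormedSpace ℂ E] {S : Set (WeakDual ℂ E)} (hS : IsCompact S) (hc : Convex ℝ S) :
    closure (convexHull ℝ (S.extremePoints ℝ)) = S := by
  have : LocallyConvexSpace ℝ (WeakDual ℂ E) :=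
    inferInstanceAs (LocallyConvexSpace ℝ (WeakBilin (topDualPairing ℂ E)))
  have : ContinuousSMul ℝ (WeakDual ℂ E) := inferInstance
  exact closure_convexHull_extremePoints hS hc

/-- A weak-* compact convex set is annihilated by every vector annihilating its extreme points. -/
theorem apply_eq_zero_of_forall_mem_extremePoints {E : Type*} [NormedAddCommGroup E]
    [NormedSpace ℂ E] {S : Set (WeakDual ℂ E)} (hS : IsCompact S) (hc : Convex ℝ S) {x : E}
    (h : ∀ g ∈ S.extremePoints ℝ, g x = 0) : ∀ f ∈ S, f x = 0 := by
  have h1 := closure_convexHull_subset_setOf_weakDual_eq_zero h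
  rw [closure_convexHull_extremePoints_weakDual hS hc] at h1
  exact fun f hf => h1 hf

section StatesVanishing

variable {B : Type*} [CStarAlgebra B] [PartialOrder B]

/-- The states of a unital C*-algebra which vanish on a given subspace. -/
def statesVanishingOn (J : Submodule ℂ B) : Set (WeakDual ℂ B) :=
  {f | (∀ x, 0 ≤ x → 0 ≤ f x) ∧ f 1 = 1 ∧ ∀ j ∈ J, f j = 0}

theorem convex_statesVanishingOn (J : Submodule ℂ B) : Convex ℝ (statesVanishingOn J) := by
  rintro f ⟨hf, hf1, hfJ⟩ g ⟨hg, hg1, hgJ⟩ s t hs ht hst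
  have happ (x : B) : (s • f + t • g) x = s • f x + t • g x := rfl
  refine ⟨fun x hx => ?_, ?_, fun j hj => ?_⟩
  · rw [happ]
    exact add_nonneg (smul_nonneg hs (hf x hx)) (smul_nonneg ht (hg x hx))
  · rw [happ, hf1, hg1, ← add_smul, hst, one_smul]
  · rw [happ, hfJ j hj, hgJ j hj, smul_zero, smul_zero, add_zero]

theorem isClosed_statesVanishingOn (J : Submodule ℂ B) : IsClosed (statesVanishingOn J) := by
  have hev (x : B) : Continuous fun f : WeakDual ℂ B => f x := WeakDual.eval_continuous x
  have hset : statesVanishingOn J = (⋂ x : B, ⋂ _ : 0 ≤ x, {f : WeakDual ℂ B | 0 ≤ f x}) ∩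
      ({f : WeakDual ℂ B | f 1 = 1} ∩ ⋂ j : B, ⋂ _ : j ∈ J, {f : WeakDual ℂ B | f j = 0}) := by
    ext f
    simp [statesVanishingOn]
  rw [hset]
  refine (isClosed_iInter fun x => isClosed_iInter fun _ => ?_).inter
    (IsClosed.inter ?_ (isClosed_iInter fun j => isClosed_iInter fun _ => ?_))
  · exact isClosed_le continuous_const (hev x)
  · exact isClosed_eq (hev 1) continuous_const
  · exact isClosed_eq (hev j) continuous_const

variable [StarOrderedRing B]

theorem norm_apply_le_of_mem_statesVanishingOn {J : Submodule ℂ B} {f : WeakDual ℂ B}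
    (hf : f ∈ statesVanishingOn J) (x : B) : ‖f x‖ ≤ 4 * ‖x‖ := by
  let φ : B →ₚ[ℂ] ℂ := PositiveLinearMap.mk₀ (f : B →ₗ[ℂ] ℂ) hf.1
  have hφ1 : ‖φ 1‖ = 1 := by
    rw [show φ 1 = 1 from hf.2.1, norm_one]
  obtain ⟨y, hy0, hyn, hy⟩ := CStarAlgebra.exists_sum_four_nonneg x
  have hb (i : Fin 4) : ‖f (Complex.I ^ (i : ℕ) • y i)‖ ≤ ‖x‖ := by
    rw [map_smul, norm_smul, norm_pow, Complex.norm_I, one_pow, one_mul]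
    have := φ.norm_apply_le_of_nonneg (y i) (hy0 i)
    rw [hφ1, one_mul] at this
    exact this.trans (hyn i)
  calc ‖f x‖ = ‖∑ i : Fin 4, f (Complex.I ^ (i : ℕ) • y i)‖ := by
        conv_lhs => rw [hy]
        rw [map_sum]
    _ ≤ ∑ _i : Fin 4, ‖x‖ := norm_sum_le_of_le _ fun i _ => hb i
    _ = 4 * ‖x‖ := by simp

theorem isCompact_statesVanishingOn (J : Submodule ℂ B) : IsCompact (statesVanishingOn J) := by
  refine (WeakDual.isCompact_closedBall (𝕜 := ℂ) (E := B) 0 4).of_isClosed_subset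
    (isClosed_statesVanishingOn J) fun f hf => ?_
  rw [Set.mem_preimage, mem_closedBall_zero_iff]
  exact ContinuousLinearMap.opNorm_le_bound _ (by norm_num)
    (norm_apply_le_of_mem_statesVanishingOn hf)

/-- A nonzero positive functional vanishing on a subspace can be rescaled to a state. -/
theorem exists_mem_statesVanishingOn_eq_smul {J : Submodule ℂ B} {ψ : B →ₗ[ℂ] ℂ} {r : ℝ}
    (hr : 0 < r) (hpos : ∀ x, 0 ≤ x → 0 ≤ ψ x) (h1 : ψ 1 = r) (hJ : ∀ j ∈ J, ψ j = 0) :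
    ∃ f ∈ statesVanishingOn J, ∀ x, f x = r⁻¹ • ψ x := by
  let φ : B →ₚ[ℂ] ℂ := PositiveLinearMap.mk₀ ψ hpos
  refine ⟨StrongDual.toWeakDual (r⁻¹ • (⟨ψ, map_continuous φ⟩ : StrongDual ℂ B)),
    ⟨fun x hx => ?_, ?_, fun j hj => ?_⟩, fun x => rfl⟩
  · exact smul_nonneg (inv_nonneg.2 hr.le) (hpos x hx)
  · change r⁻¹ • ψ 1 = 1
    rw [h1, Complex.real_smul, ← Complex.ofReal_mul, inv_mul_cancel₀ hr.ne', Complex.ofReal_one]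
  · change r⁻¹ • ψ j = 0
    rw [hJ j hj, smul_zero]

/-- A real-linear functional bounded below on a ray is nonnegative along it. -/
theorem nonneg_of_forall_lt_mul {r u : ℝ} (h : ∀ t : ℝ, 0 ≤ t → u < t * r) : 0 ≤ r := by
  by_contra! hr
  have := h (|u| / (-r)) (by have := neg_pos.2 hr; positivity)
  rw [div_mul_eq_mul_div, lt_div_iff₀ (neg_pos.2 hr)] at this
  nlinarith [neg_abs_le u]

/-- States vanishing on a closed two-sided ideal detect the elements outside of it. -/
theorem exists_mem_statesVanishingOn {J : Submodule ℂ B} (hJ : IsClosedTwoSidedIdeal J) {a : B}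
    (ha : a ∉ J) : ∃ f ∈ statesVanishingOn J, f (star a * a) ≠ 0 := by
  let C : Set B := {z | ∃ p : B, 0 ≤ p ∧ ∃ j ∈ J, z = p + j}
  have hCconv : Convex ℝ C := by
    rintro _ ⟨p, hp, j, hj, rfl⟩ _ ⟨q, hq, k, hk, rfl⟩ s t hs ht -
    refine ⟨s • p + t • q, add_nonneg (smul_nonneg hs hp) (smul_nonneg ht hq),
      (s : ℂ) • j + (t : ℂ) • k, J.add_mem (J.smul_mem _ hj) (J.smul_mem _ hk), ?_⟩
    simp only [Complex.coe_smul, smul_add]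
    abel
  have hnot : -(star a * a) ∉ closure C := by
    intro hmem
    refine ha (hJ.mem_of_star_mul_self_le fun ε hε => ?_)
    obtain ⟨_, ⟨p, hp, j, hj, rfl⟩, hdist⟩ := Metric.mem_closure_iff.1 hmem ε hε
    set d : B := -(star a * a) - (p + j) with hd
    rw [dist_eq_norm] at hdist
    have hsaa : star (star a * a) = star a * a := by simp
    have hsp : star p = p := (IsSelfAdjoint.of_nonneg hp).star_eq
    have hre : ‖(2⁻¹ : ℝ) • (d + star d)‖ ≤ ε := by
      rw [norm_smul, Real.norm_of_nonneg (by norm_num)]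
      have := norm_add_le d (star d)
      rw [norm_star] at this
      linarith
    have hsa : IsSelfAdjoint ((2⁻¹ : ℝ) • (d + star d)) :=
      (IsSelfAdjoint.all (2⁻¹ : ℝ)).smul (IsSelfAdjoint.add_star_self d)
    refine ⟨((-2⁻¹ : ℝ) : ℂ) • (j + star j), J.smul_mem _ (J.add_mem hj (hJ.star_mem hj)), ?_⟩
    have hle : -((2⁻¹ : ℝ) • (d + star d)) ≤ algebraMap ℝ B ε := by
      refine (IsSelfAdjoint.le_algebraMap_norm_self hsa.neg).trans ?_
      rw [norm_neg]
      exact algebraMap_mono B hre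
    have heq : star a * a = ((-2⁻¹ : ℝ) : ℂ) • (j + star j) +
        -((2⁻¹ : ℝ) • (d + star d)) - p := by
      rw [hd, star_sub, star_neg, hsaa, star_add, hsp, Complex.coe_smul]
      module
    calc star a * a = _ := heq
      _ ≤ ((-2⁻¹ : ℝ) : ℂ) • (j + star j) + -((2⁻¹ : ℝ) • (d + star d)) := sub_le_self _ hp
      _ ≤ _ := by gcongr
  obtain ⟨g, u, hgu, hgC⟩ :=
    RCLike.geometric_hahn_banach_point_closed (𝕜 := ℂ) hCconv.closure isClosed_closure hnot
  have hgC' : ∀ p : B, 0 ≤ p → ∀ j ∈ J, u < (g (p + j)).re := fun p hp j hj =>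
    hgC _ (subset_closure ⟨p, hp, j, hj, rfl⟩)
  have hu : u < 0 := by simpa using hgC' 0 le_rfl 0 J.zero_mem
  have hgpos : ∀ p : B, 0 ≤ p → 0 ≤ (g p).re := fun p hp =>
    nonneg_of_forall_lt_mul fun t ht => by
      simpa using hgC' (t • p) (smul_nonneg ht hp) 0 J.zero_mem
  have hgJre : ∀ j ∈ J, 0 ≤ (g j).re := fun j hj =>
    nonneg_of_forall_lt_mul fun t ht => by
      simpa using hgC' 0 le_rfl ((t : ℂ) • j) (J.smul_mem _ hj)
  have hgJ : ∀ j ∈ J, g j = 0 := by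
    intro j hj
    have h1 := hgJre _ hj
    have h2 := hgJre _ (J.neg_mem hj)
    have h3 := hgJre _ (J.smul_mem Complex.I hj)
    have h4 := hgJre _ (J.smul_mem (-Complex.I) hj)
    simp at h1 h2 h3 h4
    exact Complex.ext (le_antisymm h2 h1) (le_antisymm h3 h4)
  have hga : 0 < (g (star a * a)).re := by
    have : (g (-(star a * a))).re < 0 := lt_trans hgu hu
    simpa using this
  let ψ : B →ₗ[ℂ] ℂ :=
    { toFun := fun x => 2⁻¹ * (g x + star (g (star x)))
      map_add' := fun x y => by simp only [map_add, star_add]; ring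
      map_smul' := fun c x => by
        simp only [map_smul, star_smul, smul_eq_mul, star_mul', star_star, RingHom.id_apply]
        ring }
  have hψsa : ∀ x : B, IsSelfAdjoint x → ψ x = ((g x).re : ℂ) := fun x hx => by
    change 2⁻¹ * (g x + star (g (star x))) = _
    rw [hx.star_eq, Complex.star_def, Complex.add_conj]
    push_cast
    ring
  have hψpos : ∀ x : B, 0 ≤ x → 0 ≤ ψ x := fun x hx => by
    rw [hψsa x (.of_nonneg hx)]
    exact_mod_cast hgpos x hx
  have hψJ : ∀ j ∈ J, ψ j = 0 := fun j hj => by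
    change 2⁻¹ * (g j + star (g (star j))) = _
    rw [hgJ j hj, hgJ _ (hJ.star_mem hj)]
    simp
  have h1pos : 0 < (g 1).re := by
    have hle : star a * a ≤ algebraMap ℝ B ‖star a * a‖ :=
      IsSelfAdjoint.le_algebraMap_norm_self (.star_mul_self a)
    have := hgpos _ (sub_nonneg.2 hle)
    rw [map_sub, Algebra.algebraMap_eq_smul_one, Complex.sub_re, ← Complex.coe_smul,
      map_smul, Complex.coe_smul, Complex.smul_re, smul_eq_mul] at this
    by_contra! hneg
    have := mul_nonpos_of_nonneg_of_nonpos (norm_nonneg (star a * a)) hneg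
    linarith
  obtain ⟨f, hf, hfψ⟩ := exists_mem_statesVanishingOn_eq_smul h1pos hψpos (hψsa 1 (.one B)) hψJ
  refine ⟨f, hf, ?_⟩
  rw [hfψ, hψsa _ (.star_mul_self a)]
  exact smul_ne_zero (inv_ne_zero h1pos.ne') (by exact_mod_cast hga.ne')

/-- Extreme states vanishing on a closed two-sided ideal detect the elements outside of it. -/
theorem exists_mem_extremePoints_statesVanishingOn {J : Submodule ℂ B}
    (hJ : IsClosedTwoSidedIdeal J) {a : B} (ha : a ∉ J) :
    ∃ f ∈ (statesVanishingOn J).extremePoints ℝ, f (star a * a) ≠ 0 := by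
  by_contra! hext
  obtain ⟨f, hf, hfa⟩ := exists_mem_statesVanishingOn hJ ha
  exact hfa (apply_eq_zero_of_forall_mem_extremePoints (isCompact_statesVanishingOn J)
    (convex_statesVanishingOn J) hext f hf)

end StatesVanishing

section GNS

variable {B : Type*} [CStarAlgebra B] [PartialOrder B] [StarOrderedRing B]

/-- Every nonzero vector of a representation annihilating `J` gives, after normalization, a state
vanishing on `J`. -/
theorem exists_mem_statesVanishingOn_inner {E : Type*} [NormedAddCommGroup E]
    [InnerProductSpace ℂ E] [CompleteSpace E] {π : B →⋆ₙₐ[ℂ] (E →L[ℂ] E)} (hπ1 : π 1 = 1)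
    {J : Submodule ℂ B} (hπJ : ∀ j ∈ J, π j = 0) {η : E} (hη : η ≠ 0) :
    ∃ f ∈ statesVanishingOn J, ∀ x, f x = (‖η‖ ^ 2)⁻¹ • ⟪η, π x η⟫_ℂ := by
  let ψ : B →ₗ[ℂ] ℂ :=
    { toFun := fun x => ⟪η, π x η⟫_ℂ
      map_add' := fun x y => by rw [map_add, add_apply, inner_add_right]
      map_smul' := fun c x => by
        rw [map_smul, smul_apply, inner_smul_right, smul_eq_mul,
          RingHom.id_apply] }
  have hr : 0 < ‖η‖ ^ 2 := by have := norm_pos_iff.2 hη; positivity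
  refine exists_mem_statesVanishingOn_eq_smul (ψ := ψ) hr (fun x hx => ?_) ?_ fun j hj => ?_
  · obtain ⟨y, rfl⟩ := CStarAlgebra.nonneg_iff_eq_star_mul_self.1 hx
    change 0 ≤ ⟪η, π (star y * y) η⟫_ℂ
    rw [map_mul, map_star, mul_apply_eq_comp, ContinuousLinearMap.star_eq_adjoint,
      ContinuousLinearMap.adjoint_inner_right, inner_self_eq_norm_sq_to_K]
    change (0 : ℂ) ≤ ((‖π y η‖ : ℝ) : ℂ) ^ 2
    exact_mod_cast sq_nonneg ‖π y η‖
  · change ⟪η, π 1 η⟫_ℂ = _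
    rw [hπ1, one_apply_eq_self, inner_self_eq_norm_sq_to_K]
    push_cast
    rfl
  · change ⟪η, π j η⟫_ℂ = 0
    rw [hπJ j hj, zero_apply, inner_zero_right]

/-- A cyclic representation whose vector state is extreme among the states vanishing on a subspace
annihilated by the representation is irreducible. -/
theorem isIrredRep_of_mem_extremePoints {E : Type*} [NormedAddCommGroup E]
    [InnerProductSpace ℂ E] [CompleteSpace E] {π : B →⋆ₙₐ[ℂ] (E →L[ℂ] E)} (hπ1 : π 1 = 1)
    {J : Submodule ℂ B} (hπJ : ∀ j ∈ J, π j = 0) {ξ : E} (hξ : DenseRange fun b => π b ξ)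
    {f : WeakDual ℂ B} (hf : f ∈ (statesVanishingOn J).extremePoints ℝ)
    (hfξ : ∀ b, f b = ⟪ξ, π b ξ⟫_ℂ) : IsIrredRep B π := by
  have hnorm : ‖ξ‖ ^ 2 = 1 := by
    have := hfξ 1
    rw [hf.1.2.1, hπ1, one_apply_eq_self, inner_self_eq_norm_sq_to_K] at this
    change (1 : ℂ) = ((‖ξ‖ : ℝ) : ℂ) ^ 2 at this
    exact_mod_cast this.symm
  refine ⟨⟨ξ, fun h => by simp [h] at hnorm⟩, fun K hKc hK => ?_⟩
  have : CompleteSpace K := hKc.completeSpace_coe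
  have hKperp : ∀ b : B, ∀ x ∈ Kᗮ, π b x ∈ Kᗮ := fun b x hx => by
    rw [Submodule.mem_orthogonal] at hx ⊢
    intro y hy
    rw [← ContinuousLinearMap.adjoint_inner_left, ← ContinuousLinearMap.star_eq_adjoint, ← map_star]
    exact hx _ (hK _ y hy)
  have htop : ∀ L : Submodule ℂ E, IsClosed (L : Set E) → (∀ b : B, ∀ x ∈ L, π b x ∈ L) →
      ξ ∈ L → L = ⊤ := fun L hLc hL hξL => by
    refine eq_top_iff.2 fun x _ => ?_
    exact hLc.closure_subset_iff.2 (Set.range_subset_iff.2 fun b => hL b ξ hξL) (hξ x)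
  obtain ⟨p, hp, q, hq, hpq⟩ := K.exists_add_mem_mem_orthogonal ξ
  by_cases hp0 : p = 0
  · left
    have := htop Kᗮ K.isClosed_orthogonal hKperp (by rwa [hpq, hp0, zero_add])
    exact (Submodule.orthogonal_eq_top_iff K).1 this
  right
  by_cases hq0 : q = 0
  · exact htop K hKc hK (by rwa [hpq, hq0, add_zero])
  have hinner (b : B) : ⟪p, π b ξ⟫_ℂ = ⟪p, π b p⟫_ℂ := by
    rw [hpq, map_add, inner_add_right,
      Submodule.inner_right_of_mem_orthogonal hp (hKperp b q hq), add_zero]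
  have hinner' (b : B) : ⟪q, π b ξ⟫_ℂ = ⟪q, π b q⟫_ℂ := by
    rw [hpq, map_add, inner_add_right,
      Submodule.inner_left_of_mem_orthogonal (hK b p hp) hq, zero_add]
  have hpyth : ‖p‖ ^ 2 + ‖q‖ ^ 2 = 1 := by
    rw [← hnorm, hpq, sq, sq, sq, norm_add_sq_eq_norm_sq_add_norm_sq_of_inner_eq_zero (𝕜 := ℂ)]
    exact Submodule.inner_right_of_mem_orthogonal hp hq
  have hp2 : 0 < ‖p‖ ^ 2 := by have := norm_pos_iff.2 hp0; positivity
  have hq2 : 0 < ‖q‖ ^ 2 := by have := norm_pos_iff.2 hq0; positivity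
  obtain ⟨g, hg, hgp⟩ := exists_mem_statesVanishingOn_inner hπ1 hπJ hp0
  obtain ⟨k, hk, hkq⟩ := exists_mem_statesVanishingOn_inner hπ1 hπJ hq0
  have hgf : g = f := by
    refine hf.2 hg hk ⟨‖p‖ ^ 2, ‖q‖ ^ 2, hp2, hq2, hpyth, ?_⟩
    refine DFunLike.ext _ _ fun b => ?_
    change ‖p‖ ^ 2 • g b + ‖q‖ ^ 2 • k b = f b
    rw [hgp, hkq, smul_inv_smul₀ hp2.ne', smul_inv_smul₀ hq2.ne', hfξ, ← hinner, ← hinner',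
      ← inner_add_left, ← hpq]
  have hzero : p - ((‖p‖ ^ 2 : ℝ) : ℂ) • ξ = 0 := by
    refine hξ.eq_zero_of_inner_left (𝕜 := ℂ) fun b => ?_
    rw [inner_sub_left, inner_smul_left, Complex.conj_ofReal, hinner, ← hfξ, ← hgf, hgp,
      ← Complex.real_smul, smul_inv_smul₀ hp2.ne', sub_self]
  have hξK : ξ ∈ K := by
    have hne : ((‖p‖ ^ 2 : ℝ) : ℂ) ≠ 0 := by exact_mod_cast hp2.ne'
    rw [← inv_smul_smul₀ hne ξ, ← sub_eq_zero.1 hzero]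
    exact K.smul_mem _ hp
  exact htop K hKc hK hξK

/-- The elements outside of a closed two-sided ideal of a unital C*-algebra are detected by the
unital irreducible representations annihilating the ideal. -/
theorem exists_isIrredRep_of_notMem {B : Type u} [CStarAlgebra B] {J : Submodule ℂ B}
    (hJ : IsClosedTwoSidedIdeal J) {a : B} (ha : a ∉ J) :
    ∃ (E : Type u) (_ : NormedAddCommGroup E) (_ : InnerProductSpace ℂ E) (_ : CompleteSpace E)
      (π : B →⋆ₙₐ[ℂ] (E →L[ℂ] E)), π 1 = 1 ∧ IsIrredRep B π ∧ (∀ j ∈ J, π j = 0) ∧ π a ≠ 0 := by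
  let _ : PartialOrder B := CStarAlgebra.spectralOrder B
  let _ : StarOrderedRing B := CStarAlgebra.spectralOrderedRing B
  obtain ⟨f, hf, hfa⟩ := exists_mem_extremePoints_statesVanishingOn hJ ha
  let φ : B →ₚ[ℂ] ℂ := PositiveLinearMap.mk₀ (f : B →ₗ[ℂ] ℂ) hf.1.1
  let π : B →⋆ₙₐ[ℂ] (φ.GNS →L[ℂ] φ.GNS) := φ.gnsNonUnitalStarAlgHom
  have happ (b c : B) : π b (φ.toPreGNS c : φ.GNS) = (φ.toPreGNS (b * c) : φ.GNS) :=
    φ.gnsNonUnitalStarAlgHom_apply_coe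
  have hinner (b c : B) : ⟪(φ.toPreGNS b : φ.GNS), (φ.toPreGNS c : φ.GNS)⟫_ℂ = f (star b * c) :=
    UniformSpace.Completion.inner_coe _ _
  have hdense : DenseRange fun b : B => (φ.toPreGNS b : φ.GNS) :=
    UniformSpace.Completion.denseRange_coe.comp φ.toPreGNS.surjective.denseRange
      (UniformSpace.Completion.continuous_coe _)
  have hπ1 : π 1 = 1 := map_one φ.gnsStarAlgHom
  have hπJ : ∀ j ∈ J, π j = 0 := fun j hj => by
    refine ContinuousLinearMap.ext fun x => ?_
    refine congrFun (hdense.equalizer (π j).continuous continuous_const (funext fun c => ?_)) x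
    change π j (φ.toPreGNS c : φ.GNS) = 0
    rw [happ, ← inner_self_eq_zero (𝕜 := ℂ), hinner]
    exact hf.1.2.2 _ (hJ.2.1 _ _ (hJ.2.2 _ _ hj))
  refine ⟨φ.GNS, inferInstance, inferInstance, inferInstance, π, hπ1, ?_, hπJ, fun h => hfa ?_⟩
  · refine isIrredRep_of_mem_extremePoints hπ1 hπJ (ξ := (φ.toPreGNS 1 : φ.GNS)) ?_ hf fun b => ?_
    · simpa only [happ, mul_one] using hdense
    · rw [happ, hinner, star_one, one_mul, mul_one]
  · have : π a (φ.toPreGNS 1 : φ.GNS) = 0 := by rw [h, zero_apply]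
    rw [happ, mul_one] at this
    rw [← hinner, this, inner_zero_left]

end GNS

section Unitization

variable {A : Type u} [NonUnitalCStarAlgebra A]

open Unitization in
/-- A closed two-sided ideal remains one in the unitization. -/
theorem IsClosedTwoSidedIdeal.map_inr {I : Submodule ℂ A} (hI : IsClosedTwoSidedIdeal I) :
    IsClosedTwoSidedIdeal (I.map (inrNonUnitalAlgHom ℂ A : A →ₗ[ℂ] Unitization ℂ A)) := by
  refine ⟨?_, ?_, ?_⟩
  · exact (isometry_inr (𝕜 := ℂ) (A := A)).isClosedEmbedding.isClosedMap _ hI.1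
  · rintro x _ ⟨i, hi, rfl⟩
    refine ⟨x.fst • i + x.snd * i, I.add_mem (I.smul_mem _ hi) (hI.2.1 _ _ hi), ?_⟩
    refine Unitization.ext ?_ ?_ <;> simp
  · rintro x _ ⟨i, hi, rfl⟩
    refine ⟨x.fst • i + i * x.snd, I.add_mem (I.smul_mem _ hi) (hI.2.2 _ _ hi), ?_⟩
    refine Unitization.ext ?_ ?_ <;> simp

open Unitization in
/-- The elements outside of a closed two-sided ideal of a C*-algebra are detected by the
irreducible representations annihilating the ideal. -/
theorem IsClosedTwoSidedIdeal.exists_isIrredRep {I : Submodule ℂ A}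
    (hI : IsClosedTwoSidedIdeal I) {a : A} (ha : a ∉ I) :
    ∃ (E : Type u) (_ : NormedAddCommGroup E) (_ : InnerProductSpace ℂ E) (_ : CompleteSpace E)
      (π : A →⋆ₙₐ[ℂ] (E →L[ℂ] E)), IsIrredRep A π ∧ (∀ i ∈ I, π i = 0) ∧ π a ≠ 0 := by
  have ha' : (a : Unitization ℂ A) ∉
      I.map (inrNonUnitalAlgHom ℂ A : A →ₗ[ℂ] Unitization ℂ A) := by
    rintro ⟨i, hi, hia⟩
    exact ha (inr_injective hia ▸ hi)
  obtain ⟨E, _, _, _, π, hπ1, hπ, hπI, hπa⟩ := exists_isIrredRep_of_notMem hI.map_inr ha'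
  refine ⟨E, _, _, _, π.comp (inrNonUnitalStarAlgHom ℂ A), ⟨hπ.1, fun K hKc hK => ?_⟩,
    fun i hi => hπI _ ⟨i, hi, rfl⟩, hπa⟩
  refine hπ.2 K hKc fun b x hx => ?_
  have hb : b = b.fst • (1 : Unitization ℂ A) + (b.snd : Unitization ℂ A) :=
    Unitization.ext (by simp) (by simp)
  rw [hb, map_add, map_smul, hπ1]
  exact K.add_mem (K.smul_mem _ hx) (hK b.snd x hx)

end Unitization

/-- A closed two-sided ideal of a C*-algebra is the intersection of the kernels of the
irreducible representations annihilating it; consequently two closed two-sided ideals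
annihilated by exactly the same irreducible representations coincide. -/
theorem closed_ideal_eq_iInf_kernels
    {A : Type u} [NonUnitalNormedRing A] [NormedSpace ℂ A] [StarRing A]
    [CStarRing A] [CompleteSpace A] [IsScalarTower ℂ A A] [SMulCommClass ℂ A A]
    [StarModule ℂ A] :
    (∀ I : Submodule ℂ A, IsClosedTwoSidedIdeal I →
      ∀ a : A, a ∈ I ↔
        ∀ (H : Type u) [NormedAddCommGroup H] [InnerProductSpace ℂ H] [CompleteSpace H]
          (π : A →⋆ₙₐ[ℂ] (H →L[ℂ] H)), IsIrredRep A π →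
            (∀ i ∈ I, π i = 0) → π a = 0) ∧
    (∀ I J : Submodule ℂ A, IsClosedTwoSidedIdeal I → IsClosedTwoSidedIdeal J →
      (∀ (H : Type u) [NormedAddCommGroup H] [InnerProductSpace ℂ H] [CompleteSpace H]
        (π : A →⋆ₙₐ[ℂ] (H →L[ℂ] H)), IsIrredRep A π →
          ((∀ i ∈ I, π i = 0) ↔ ∀ j ∈ J, π j = 0)) → I = J) := by
  let _ : NonUnitalCStarAlgebra A := {}
  have key : ∀ I : Submodule ℂ A, IsClosedTwoSidedIdeal I →
      ∀ a : A, a ∈ I ↔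
        ∀ (H : Type u) [NormedAddCommGroup H] [InnerProductSpace ℂ H] [CompleteSpace H]
          (π : A →⋆ₙₐ[ℂ] (H →L[ℂ] H)), IsIrredRep A π →
            (∀ i ∈ I, π i = 0) → π a = 0 := by
    refine fun I hI a => ⟨fun ha H _ _ _ π _ hπI => hπI a ha, fun h => ?_⟩
    by_contra ha
    obtain ⟨E, _, _, _, π, hπ, hπI, hπa⟩ := hI.exists_isIrredRep ha
    exact hπa (h E π hπ hπI)
  refine ⟨key, fun I J hI hJ h => Submodule.ext fun a => ?_⟩
  rw [key I hI, key J hJ]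
  exact ⟨fun ha H _ _ _ π hπ hπJ => ha H π hπ ((h H π hπ).2 hπJ),
    fun ha H _ _ _ π hπ hπI => ha H π hπ ((h H π hπ).1 hπI)⟩
end
end

section
/- Let A be a C*-algebra and let B be a nonzero hereditary C*-subalgebra of A. Then every pure state of B has a unique extension to a pure state of A, and the resulting extension map Ξ from the set of pure states of B to the set of pure states of A is a homeomorphism onto its image, where the pure states of B carry the weak* topology of the dual of B and the pure states of A carry the weak* topology of the dual of A. -/
open scoped ComplexOrder InnerProductSpace

noncomputable section

variable (A : Type*) [NonUnitalNormedRing A] [NormedSpace ℂ A] [StarRing A]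

variable {H : Type*} [NormedAddCommGroup H] [InnerProductSpace ℂ H] [CompleteSpace H]

/-- If a contractive functional almost attains its norm at `x` and `y` is almost orthogonal to `x`
in the sense that `‖x + c • y‖` grows quadratically, then the functional is small at `y`. -/
lemma mul_norm_apply_le_of_norm_add_smul_le {E : Type*} [NormedAddCommGroup E] [NormedSpace ℂ E]
    (ψ : E →L[ℂ] ℂ) (hψ : ‖ψ‖ ≤ 1) {x y : E} {δ t K : ℝ} (ht : 0 ≤ t)
    (hx : 1 - δ ≤ (ψ x).re) (h : ∀ c : ℂ, ‖c‖ = t → ‖x + c • y‖ ^ 2 ≤ 1 + 2 * K) :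
    t * ‖ψ y‖ ≤ δ + K := by
  obtain ⟨u, hu, huy⟩ := RCLike.exists_norm_eq_mul_self (ψ y)
  have h1 := h (t * u) (by simp [hu, abs_of_nonneg ht])
  have h2 : (ψ (x + ((t : ℂ) * u) • y)).re = (ψ x).re + t * ‖ψ y‖ := by
    rw [map_add, map_smul, smul_eq_mul, mul_assoc, ← huy, RCLike.ofReal_eq_complex_ofReal,
      ← Complex.ofReal_mul, Complex.add_re,
      Complex.ofReal_re]
  have h3 : (ψ (x + ((t : ℂ) * u) • y)).re ≤ ‖x + ((t : ℂ) * u) • y‖ :=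
    (Complex.re_le_norm _).trans (ψ.le_of_opNorm_le hψ _ |>.trans_eq (one_mul _))
  nlinarith [sq_nonneg (‖x + ((t : ℂ) * u) • y‖ - 1)]

lemma norm_add_smul_sq_le_of_norm_mul_star_le {A : Type*} [NonUnitalCStarAlgebra A] {x y : A}
    {η M : ℝ} (hx : ‖x‖ ≤ 1) (hxy : ‖x * star y‖ ≤ η) (hy : ‖y‖ ≤ M) (c : ℂ) :
    ‖x + c • y‖ ^ 2 ≤ 1 + 2 * (‖c‖ * η + ‖c‖ ^ 2 * M ^ 2 / 2) := by
  have hxy' : ‖y * star x‖ ≤ η := by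
    rw [← norm_star]; simpa using hxy
  have e : (x + c • y) * star (x + c • y) =
      x * star x + star c • (x * star y) + (c • (y * star x) + (c * star c) • (y * star y)) := by
    simp only [star_add, star_smul, add_mul, mul_add, smul_mul_assoc, mul_smul_comm, mul_smul,
      smul_add]
    rw [smul_comm c (star c)]; abel
  have h1 : ‖x * star x‖ ≤ 1 := by
    rw [CStarRing.norm_self_mul_star]; nlinarith [norm_nonneg x]
  have h2 : ‖star c • (x * star y)‖ ≤ ‖c‖ * η := by
    rw [norm_smul, norm_star]; gcongr
  have h3 : ‖c • (y * star x)‖ ≤ ‖c‖ * η := by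
    rw [norm_smul]; gcongr
  have h4 : ‖(c * star c) • (y * star y)‖ ≤ ‖c‖ ^ 2 * M ^ 2 := by
    have hM : 0 ≤ M := (norm_nonneg y).trans hy
    rw [norm_smul, norm_mul, norm_star, CStarRing.norm_self_mul_star, sq, sq]; gcongr
  rw [sq, ← CStarRing.norm_self_mul_star, e]
  have := norm_add₄_le (a := x * star x) (b := star c • (x * star y)) (c := c • (y * star x))
    (d := (c * star c) • (y * star y))
  rw [add_assoc (x * star x + star c • (x * star y))] at this
  linarith

lemma norm_add_smul_sq_le_of_norm_star_mul_le {A : Type*} [NonUnitalCStarAlgebra A] {x y : A}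
    {η M : ℝ} (hx : ‖x‖ ≤ 1) (hxy : ‖star x * y‖ ≤ η) (hy : ‖y‖ ≤ M) (c : ℂ) :
    ‖x + c • y‖ ^ 2 ≤ 1 + 2 * (‖c‖ * η + ‖c‖ ^ 2 * M ^ 2 / 2) := by
  have := norm_add_smul_sq_le_of_norm_mul_star_le (x := star x) (y := star y) (η := η) (M := M)
    (by rwa [norm_star]) (by rwa [star_star]) (by rwa [norm_star]) (star c)
  rwa [← star_smul, ← star_add, norm_star, norm_star] at this

lemma ContinuousLinearMap.exists_norm_le_one_lt_re_apply {E : Type*} [NormedAddCommGroup E]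
    [NormedSpace ℂ E] (τ : E →L[ℂ] ℂ) {r : ℝ} (hr : r < ‖τ‖) :
    ∃ x : E, ‖x‖ ≤ 1 ∧ r < (τ x).re := by
  obtain ⟨x, hx, hr⟩ := τ.exists_lt_apply_of_lt_opNorm hr
  obtain ⟨u, hu, hux⟩ := RCLike.exists_norm_eq_mul_self (τ x)
  refine ⟨u • x, by rw [norm_smul, hu, one_mul]; exact hx.le, ?_⟩
  rw [map_smul, smul_eq_mul, ← hux]
  exact hr

/-- A C*-algebra contains self-adjoint contractions acting almost as a two-sided unit on a given
element. -/
lemma exists_isSelfAdjoint_norm_sub_mul_lt {A : Type*} [NonUnitalCStarAlgebra A] (x : A)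
    {ε : ℝ} (hε : 0 < ε) :
    ∃ f : A, IsSelfAdjoint f ∧ ‖f‖ ≤ 1 ∧ ‖x - x * f‖ < ε ∧ ‖x - f * x‖ < ε := by
  let _ := CStarAlgebra.spectralOrder A
  let _ := CStarAlgebra.spectralOrderedRing A
  have h := CStarAlgebra.increasingApproximateUnit A
  have := h.neBot
  have hl := Metric.tendsto_nhds.1 (h.tendsto_mul_left x) ε hε
  have hr := Metric.tendsto_nhds.1 (h.tendsto_mul_right x) ε hε
  obtain ⟨f, h1, h2, h3, h4⟩ := (h.eventually_isSelfAdjoint.and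
    (h.eventually_norm.and (hl.and hr))).exists
  refine ⟨f, h1, h2, ?_, ?_⟩
  · rwa [dist_comm, dist_eq_norm] at h3
  · rwa [dist_comm, dist_eq_norm] at h4

/-- Contractive functionals which almost attain norm one at a suitable `x ∈ B` are uniformly
determined, up to `ε`, at a given `a` by their value at some compression `f * a * f`, `f ∈ B`. -/
lemma exists_forall_norm_apply_sub_apply_conj_le {A : Type*} [NonUnitalCStarAlgebra A]
    (B : NonUnitalStarSubalgebra ℂ A) (hB : IsClosed (B : Set A)) (τ : B →L[ℂ] ℂ) (hτ : ‖τ‖ = 1)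
    (a : A) {ε : ℝ} (hε : 0 < ε) :
    ∃ δ : ℝ, ∃ x : B, 1 - δ < (τ x).re ∧ ∃ f ∈ B, IsSelfAdjoint f ∧
      ∀ ψ : A →L[ℂ] ℂ, ‖ψ‖ ≤ 1 → 1 - δ ≤ (ψ x).re → ‖ψ a - ψ (f * a * f)‖ ≤ ε := by
  obtain ⟨t, ht, htε⟩ : ∃ t : ℝ, 0 < t ∧ 8 * t * ‖a‖ ^ 2 ≤ ε := by
    refine ⟨ε / (8 * (‖a‖ ^ 2 + 1)), by positivity, ?_⟩
    rw [show 8 * (ε / (8 * (‖a‖ ^ 2 + 1))) * ‖a‖ ^ 2 = ε * (‖a‖ ^ 2 / (‖a‖ ^ 2 + 1)) by field_simp]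
    refine mul_le_of_le_one_right hε.le ?_
    rw [div_le_one (by positivity)]
    linarith
  obtain ⟨x, hx1, hxτ⟩ := τ.exists_norm_le_one_lt_re_apply (r := 1 - t * ε / 8)
    (by rw [hτ]; linarith [mul_pos ht hε])
  have := hB
  obtain ⟨f, hf, hf1, hxf, hfx⟩ := exists_isSelfAdjoint_norm_sub_mul_lt (A := B) x
    (ε := ε / 8 / (‖a‖ + 1)) (by positivity)
  refine ⟨t * ε / 8, x, hxτ, f, f.2, congrArg Subtype.val hf, fun ψ hψ hψx ↦ ?_⟩
  obtain ⟨x, hxB⟩ := x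
  obtain ⟨f, hfB⟩ := f
  replace hf : star f = f := congrArg Subtype.val hf
  replace hxf : ‖x - x * f‖ < _ := hxf
  replace hfx : ‖x - f * x‖ < _ := hfx
  replace hf1 : ‖f‖ ≤ 1 := hf1
  replace hx1 : ‖x‖ ≤ 1 := hx1
  change 1 - t * ε / 8 ≤ (ψ x).re at hψx
  have hη : ε / 8 / (‖a‖ + 1) * ‖a‖ ≤ ε / 8 := by
    rw [div_mul_eq_mul_div, div_le_iff₀ (by positivity)]
    nlinarith [norm_nonneg a]
  have hfa : ‖f * a‖ ≤ ‖a‖ := (norm_mul_le _ _).trans (mul_le_of_le_one_left (norm_nonneg _) hf1)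
  have hfaf : ‖f * a * f‖ ≤ ‖a‖ :=
    (norm_mul_le _ _).trans ((mul_le_of_le_one_right (norm_nonneg _) hf1).trans hfa)
  have small (y : A) (h : ∀ c : ℂ, ‖x + c • y‖ ^ 2 ≤
      1 + 2 * (‖c‖ * (ε / 8) + ‖c‖ ^ 2 * (2 * ‖a‖) ^ 2 / 2)) : ‖ψ y‖ ≤ ε / 2 := by
    have key := mul_norm_apply_le_of_norm_add_smul_le ψ hψ (y := y) ht.le hψx
      (fun c hc ↦ hc ▸ h c)
    refine le_of_mul_le_mul_left (key.trans ?_) ht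
    nlinarith
  have e : ψ a - ψ (f * a * f) = ψ (a - f * a) + ψ (f * a - f * a * f) := by
    rw [map_sub, map_sub]; ring
  rw [e]
  refine (norm_add_le _ _).trans ((add_le_add (small _ fun c ↦ ?_) (small _ fun c ↦ ?_)).trans_eq
    (add_halves ε))
  · refine norm_add_smul_sq_le_of_norm_star_mul_le hx1 ?_ ?_ c
    · rw [show star x * (a - f * a) = star (x - f * x) * a by
        rw [star_sub, star_mul, hf, mul_sub, sub_mul, mul_assoc]]
      refine (norm_mul_le _ _).trans (le_trans ?_ hη)
      rw [norm_star]; gcongr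
    · exact (norm_sub_le _ _).trans (by linarith)
  · refine norm_add_smul_sq_le_of_norm_mul_star_le hx1 ?_ ?_ c
    · rw [show x * star (f * a - f * a * f) = (x - x * f) * (star a * f) by
        simp only [star_sub, star_mul, hf, mul_sub, sub_mul, mul_assoc]]
      refine (norm_mul_le _ _).trans (le_trans ?_ hη)
      have : ‖star a * f‖ ≤ ‖a‖ := (norm_mul_le _ _).trans
        ((norm_star a).symm ▸ mul_le_of_le_one_right (norm_nonneg _) hf1)
      gcongr
    · exact (norm_sub_le _ _).trans (by linarith)

section Hereditary

variable {A : Type*} [NonUnitalCStarAlgebra A] [PartialOrder A] [StarOrderedRing A]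
  {B : NonUnitalStarSubalgebra ℂ A}

lemma IsHereditary.conj_mem (hB : IsHereditary A B) {f : A} (hf : f ∈ B) (hfs : IsSelfAdjoint f)
    (a : A) : f * a * f ∈ B := by
  have ha : a ∈ Submodule.span ℂ {a : A | 0 ≤ a} := by
    rw [CStarAlgebra.span_nonneg]; trivial
  induction ha using Submodule.span_induction with
  | mem a ha =>
    have h := CStarAlgebra.star_left_conjugate_le_norm_smul (a := f) (b := a)
      (IsSelfAdjoint.of_nonneg ha)
    have h0 := star_left_conjugate_nonneg ha f
    rw [hfs.star_eq] at h h0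
    have : ‖a‖ • (f * f) ∈ B :=
      B.toNonUnitalSubalgebra.toSubmodule.smul_of_tower_mem ‖a‖ (B.mul_mem hf hf)
    exact hB.2 _ _ this h0 h
  | zero => simp
  | add x y _ _ hx hy => rw [mul_add, add_mul]; exact add_mem hx hy
  | smul c x _ hx => rw [mul_smul_comm, smul_mul_assoc]; exact SMulMemClass.smul_mem c hx

/-- Positive elements of a closed star subalgebra have a positive square root in it. -/
lemma exists_mem_star_mul_self_eq (hB : IsClosed (B : Set A)) {c : A} (hc : c ∈ B) (h0 : 0 ≤ c) :
    ∃ s ∈ B, star s * s = c := by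
  refine ⟨CFC.sqrt c, ?_, ?_⟩
  · rw [CFC.sqrt_eq_real_sqrt c]
    have := hB
    exact cfcₙ_mem (𝕜 := ℝ) (𝕜' := ℂ) _ hc
  · rw [(IsSelfAdjoint.of_nonneg (CFC.sqrt_nonneg c)).star_eq, CFC.sqrt_mul_sqrt_self c]

lemma IsHereditary.eq_of_norm_le_one_of_forall_apply_eq (hB : IsHereditary A B) {τ : B →L[ℂ] ℂ} (hτ : ‖τ‖ = 1)
    {φ ψ : A →L[ℂ] ℂ} (hφ : ‖φ‖ ≤ 1) (hψ : ‖ψ‖ ≤ 1) (hφτ : ∀ b : B, φ b = τ b)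
    (hψτ : ∀ b : B, ψ b = τ b) : φ = ψ := by
  ext a
  refine eq_of_forall_dist_le fun ε hε ↦ ?_
  obtain ⟨δ, x, hx, f, hf, hfs, h⟩ :=
    exists_forall_norm_apply_sub_apply_conj_le B hB.1 τ hτ a (half_pos hε)
  have h1 := h φ hφ (by rw [hφτ]; exact hx.le)
  have h2 := h ψ hψ (by rw [hψτ]; exact hx.le)
  have e : φ (f * a * f) = ψ (f * a * f) :=
    (hφτ ⟨_, hB.conj_mem hf hfs a⟩).trans (hψτ ⟨_, hB.conj_mem hf hfs a⟩).symm
  rw [← dist_eq_norm] at h1 h2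
  rw [e] at h1
  linarith [dist_triangle_right (φ a) (ψ a) (ψ (f * a * f))]

lemma IsState.exists_extension (hB : IsHereditary A B) {τ : B →L[ℂ] ℂ} (hτ : IsState B τ) :
    ∃ φ : A →L[ℂ] ℂ, IsState A φ ∧ ∀ b : B, φ b = τ b := by
  obtain ⟨φ, hφτ, hφ⟩ := exists_extension_norm_eq B.toNonUnitalSubalgebra.toSubmodule τ
  replace hφτ : ∀ b : B, φ b = τ b := hφτ
  replace hφ : ‖φ‖ = 1 := hφ.trans hτ.2
  refine ⟨φ, ⟨fun a ↦ ?_, hφ⟩, hφτ⟩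
  have hcl : IsClosed {z : ℂ | 0 ≤ z} := isClosed_Ici
  refine hcl.closure_subset (Metric.mem_closure_iff.2 fun ε hε ↦ ?_)
  obtain ⟨δ, x, hx, f, hf, hfs, h⟩ :=
    exists_forall_norm_apply_sub_apply_conj_le B hB.1 τ hτ.2 (star a * a) (half_pos hε)
  have h1 := h φ hφ.le (by rw [hφτ]; exact hx.le)
  refine ⟨_, ?_, lt_of_le_of_lt ((dist_eq_norm _ _).trans_le h1) (half_lt_self hε)⟩
  have h0 := star_left_conjugate_nonneg (star_mul_self_nonneg a) f
  rw [hfs.star_eq] at h0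
  obtain ⟨s, hs, e⟩ := exists_mem_star_mul_self_eq hB.1 (hB.conj_mem hf hfs _) h0
  rw [← e]
  exact (hτ.1 ⟨s, hs⟩).trans_eq (hφτ (star ⟨s, hs⟩ * ⟨s, hs⟩)).symm

lemma IsPureState.of_extension (hB : IsHereditary A B) {τ : B →L[ℂ] ℂ} (hτ : IsPureState B τ)
    {φ : A →L[ℂ] ℂ} (hφ : IsState A φ) (hφτ : ∀ b : B, φ b = τ b) : IsPureState A φ := by
  refine ⟨hφ, fun φ₁ h₁ φ₂ h₂ hseg ↦ ?_⟩
  obtain ⟨s, t, hs, ht, hst, e⟩ := hseg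
  let ι : B →L[ℂ] A := B.toNonUnitalSubalgebra.toSubmodule.subtypeL
  have hι (ψ : A →L[ℂ] ℂ) (hψ : IsState A ψ) : ‖ψ.comp ι‖ ≤ 1 :=
    ContinuousLinearMap.opNorm_le_bound _ zero_le_one fun b ↦ ψ.le_of_opNorm_le hψ.2.le b
  have eτ : s • φ₁.comp ι + t • φ₂.comp ι = τ := by
    ext b
    rw [← hφτ, ← e]; rfl
  have hnorm : 1 ≤ s * ‖φ₁.comp ι‖ + t * ‖φ₂.comp ι‖ := by
    rw [← hτ.1.2, ← eτ]
    refine (norm_add_le _ _).trans_eq ?_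
    rw [norm_smul, norm_smul, Real.norm_of_nonneg hs.le, Real.norm_of_nonneg ht.le]
  have hn₁ := hι φ₁ h₁
  have hn₂ := hι φ₂ h₂
  have s₁ : IsState B (φ₁.comp ι) := ⟨fun b ↦ h₁.1 b, by nlinarith⟩
  have s₂ : IsState B (φ₂.comp ι) := ⟨fun b ↦ h₂.1 b, by nlinarith⟩
  have := hτ.2 s₁ s₂ ⟨s, t, hs, ht, hst, eτ⟩
  exact IsHereditary.eq_of_norm_le_one_of_forall_apply_eq hB hτ.1.2 h₁.2.le hφ.2.le
    (fun b ↦ DFunLike.congr_fun this b) hφτ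

/-- A map assigning to each pure state of `B` a pure state extending it is weak*-continuous. -/
lemma IsPureState.continuous_extension (hB : IsHereditary A B)
    (Ξ : {τ : WeakDual ℂ B // IsPureState B τ} → {φ : WeakDual ℂ A // IsPureState A φ})
    (hΞ : ∀ τ, ∀ b : B, (Ξ τ).1 (b : A) = τ.1 b) : Continuous Ξ := by
  have heval (b : B) : Continuous fun τ : {τ : WeakDual ℂ B // IsPureState B τ} ↦ τ.1 b :=
    (WeakDual.eval_continuous b).comp continuous_subtype_val
  refine continuous_induced_rng.2 (WeakDual.continuous_of_continuous_eval fun a ↦ ?_)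
  refine continuous_iff_continuousAt.2 fun τ ↦ Metric.tendsto_nhds.2 fun ε hε ↦ ?_
  obtain ⟨δ, x, hx, f, hf, hfs, h⟩ :=
    exists_forall_norm_apply_sub_apply_conj_le B hB.1 τ.1 τ.2.1.2 a (ε := ε / 4) (by positivity)
  have hc := hB.conj_mem hf hfs a
  filter_upwards [(Complex.continuous_re.comp (heval x)).continuousAt.eventually_const_lt hx,
    Metric.tendsto_nhds.1 (heval ⟨_, hc⟩).continuousAt (ε / 4) (by positivity)] with σ h1 h2
  have k (σ) (h1 : 1 - δ < (σ.1 x).re) := h (Ξ σ).1 (Ξ σ).2.1.2.le ((hΞ σ x).symm ▸ h1.le)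
  have kσ := k σ h1
  have kτ := k τ hx
  rw [← dist_eq_norm] at kσ kτ
  rw [← hΞ, ← hΞ] at h2
  have := dist_triangle4 ((Ξ σ).1 a) ((Ξ σ).1 (f * a * f)) ((Ξ τ).1 (f * a * f)) ((Ξ τ).1 a)
  rw [dist_comm ((Ξ τ).1 (f * a * f))] at this
  replace h2 : dist ((Ξ σ).1 (f * a * f)) ((Ξ τ).1 (f * a * f)) < ε / 4 := h2
  change dist ((Ξ σ).1 a) ((Ξ σ).1 (f * a * f)) ≤ ε / 4 at kσ
  change dist ((Ξ τ).1 a) ((Ξ τ).1 (f * a * f)) ≤ ε / 4 at kτ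
  change dist ((Ξ σ).1 a) ((Ξ τ).1 a) < ε
  linarith

lemma IsPureState.isEmbedding_extension (hB : IsHereditary A B)
    (Ξ : {τ : WeakDual ℂ B // IsPureState B τ} → {φ : WeakDual ℂ A // IsPureState A φ})
    (hΞ : ∀ τ, ∀ b : B, (Ξ τ).1 (b : A) = τ.1 b) : Topology.IsEmbedding Ξ := by
  let ι : B →L[ℂ] A := B.toNonUnitalSubalgebra.toSubmodule.subtypeL
  let res : {φ : WeakDual ℂ A // IsPureState A φ} → WeakDual ℂ B :=
    fun φ ↦ ContinuousLinearMap.comp (φ.1 : A →L[ℂ] ℂ) ι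
  have hres : Continuous res := WeakDual.continuous_of_continuous_eval fun b ↦
    (WeakDual.eval_continuous (b : A)).comp continuous_subtype_val
  refine .of_comp (IsPureState.continuous_extension hB Ξ hΞ) hres ?_
  have : res ∘ Ξ = Subtype.val := by
    funext τ
    exact DFunLike.ext _ _ fun b ↦ hΞ τ b
  rw [this]
  exact .subtypeVal

end Hereditary

/-- Every pure state of a nonzero hereditary C*-subalgebra `B` of `A` extends uniquely
to a pure state of `A`, and the extension map is a homeomorphism onto its image for
the weak* topologies. -/
theorem pure_state_extension_embedding
    {A : Type*} [NonUnitalNormedRing A] [NormedSpace ℂ A] [StarRing A]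
    [CStarRing A] [CompleteSpace A] [IsScalarTower ℂ A A] [SMulCommClass ℂ A A]
    [StarModule ℂ A] [PartialOrder A] [StarOrderedRing A]
    (B : NonUnitalStarSubalgebra ℂ A) (hB : IsHereditary A B)
    (hBne : ∃ b ∈ B, b ≠ (0 : A)) :
    ∃ Ξ : {τ : WeakDual ℂ ↥B // IsPureState ↥B τ} →
          {φ : WeakDual ℂ A // IsPureState A φ},
      -- `Ξ τ` extends `τ`
      (∀ τ, ∀ b : ↥B, (Ξ τ).1 (b : A) = τ.1 b) ∧
      -- the extension to a pure state is unique
      (∀ τ, ∀ φ : A →L[ℂ] ℂ, IsPureState A φ →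
        (∀ b : ↥B, φ (b : A) = τ.1 b) →
        φ = ((Ξ τ).1 : A →L[ℂ] ℂ)) ∧
      -- `Ξ` is a homeomorphism onto its image (for the weak* topologies)
      Topology.IsEmbedding Ξ := by
  let _ : NonUnitalCStarAlgebra A := {}
  have hext (τ : {τ : WeakDual ℂ B // IsPureState B τ}) :
      ∃ φ : {φ : WeakDual ℂ A // IsPureState A φ}, ∀ b : B, φ.1 (b : A) = τ.1 b := by
    obtain ⟨φ, hφ, hφτ⟩ := IsState.exists_extension hB τ.2.1
    exact ⟨⟨φ, IsPureState.of_extension hB τ.2 hφ hφτ⟩, hφτ⟩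
  choose Ξ hΞ using hext
  exact ⟨Ξ, hΞ, fun τ φ hφ hφτ ↦ IsHereditary.eq_of_norm_le_one_of_forall_apply_eq hB τ.2.1.2 hφ.1.2.le
    (Ξ τ).2.1.2.le hφτ (hΞ τ), IsPureState.isEmbedding_extension hB Ξ hΞ⟩
end
end
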